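/- arXiv:2102.09263 — 3 statements merged into one kernel-verified Lean document; each statement's English description precedes it below -/
import Mathlib

section
/- Let f: A → B be a ring homomorphism. The following are equivalent: (1) A → B is flat and the multiplication map B ⊗_A B → B is an isomorphism; (2) for every prime ideal p of B, the localization of A at the prime f⁻¹(p) equals (maps isomorphically onto) the localization of B at f⁻¹(p); (3) the induced map Spec B → Spec A is injective and for every prime p of B, the localization A_{f⁻¹(p)} maps isomorphically onto B_p. -/
open TensorProduct

section LocalizationMap

variable {A B : Type*} [CommRing A] [CommRing B] {f : A →+* B} {M : Submonoid A}

theorem IsLocalization.map_injective_iff {T : Submonoid B} (hT : M ≤ T.comap f)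
    (S Q : Type*) [CommRing S] [CommRing Q] [Algebra A S] [Algebra B Q]
    [IsLocalization M S] [IsLocalization T Q] :
    Function.Injective (IsLocalization.map (S := S) Q f hT) ↔
      ∀ a, ∀ c ∈ T, c * f a = 0 → ∃ s ∈ M, s * a = 0 := by
  rw [injective_iff_map_eq_zero]
  constructor
  · intro h a c hc hca
    have := h (algebraMap A S a) (by
      rw [IsLocalization.map_eq, IsLocalization.map_eq_zero_iff T]
      exact ⟨⟨c, hc⟩, hca⟩)
    rw [IsLocalization.map_eq_zero_iff M] at this
    obtain ⟨s, hs⟩ := this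
    exact ⟨s, s.2, hs⟩
  · intro h x hx
    obtain ⟨a, s, rfl⟩ := IsLocalization.exists_mk'_eq M x
    rw [IsLocalization.map_mk', IsLocalization.mk'_eq_zero_iff] at hx
    obtain ⟨c, hc⟩ := hx
    obtain ⟨t, ht, hta⟩ := h a c c.2 hc
    rw [IsLocalization.mk'_eq_zero_iff]
    exact ⟨⟨t, ht⟩, hta⟩

theorem IsLocalization.map_surjective_iff {T : Submonoid B} (hT : M ≤ T.comap f)
    (S Q : Type*) [CommRing S] [CommRing Q] [Algebra A S] [Algebra B Q]
    [IsLocalization M S] [IsLocalization T Q] :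
    Function.Surjective (IsLocalization.map (S := S) Q f hT) ↔
      ∀ b, ∀ d ∈ T, ∃ a, ∃ s ∈ M, ∃ c ∈ T, c * (f s * b) = c * (d * f a) := by
  constructor
  · intro h b d hd
    obtain ⟨x, hx⟩ := h (IsLocalization.mk' Q b ⟨d, hd⟩)
    obtain ⟨a, s, rfl⟩ := IsLocalization.exists_mk'_eq M x
    rw [IsLocalization.map_mk', IsLocalization.mk'_eq_iff_eq, IsLocalization.eq_iff_exists T] at hx
    obtain ⟨c, hc⟩ := hx
    exact ⟨a, s, s.2, c, c.2, hc.symm⟩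
  · intro h y
    obtain ⟨b, d, rfl⟩ := IsLocalization.exists_mk'_eq T y
    obtain ⟨a, s, hs, c, hc, hcs⟩ := h b d d.2
    refine ⟨IsLocalization.mk' S a ⟨s, hs⟩, ?_⟩
    rw [IsLocalization.map_mk', IsLocalization.mk'_eq_iff_eq, IsLocalization.eq_iff_exists T]
    exact ⟨⟨c, hc⟩, hcs.symm⟩

theorem IsLocalization.map_bijective_iff_of_submonoid_map
    (S Q : Type*) [CommRing S] [CommRing Q] [Algebra A S] [Algebra B Q]
    [IsLocalization M S] [IsLocalization (M.map f) Q] :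
    Function.Bijective
        (IsLocalization.map (S := S) (T := M.map f) Q f (Submonoid.le_comap_map _)) ↔
      (∀ a, f a = 0 → ∃ s ∈ M, s * a = 0) ∧ ∀ b, ∃ a, ∃ s ∈ M, f s * b = f a := by
  rw [Function.Bijective, IsLocalization.map_injective_iff, IsLocalization.map_surjective_iff]
  refine and_congr ⟨fun h a ha ↦ h a 1 (one_mem _) (by simp [ha]), ?_⟩ ⟨fun h b ↦ ?_, ?_⟩
  · rintro h a _ ⟨t, ht, rfl⟩ hta
    obtain ⟨s, hs, hsa⟩ := h (t * a) (by rw [map_mul, hta])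
    exact ⟨s * t, mul_mem hs ht, by rw [mul_assoc, hsa]⟩
  · obtain ⟨a, s, hs, _, ⟨t, ht, rfl⟩, h⟩ := h b 1 (one_mem _)
    exact ⟨t * a, t * s, mul_mem ht hs, by simpa [mul_assoc] using h⟩
  · rintro h b _ ⟨t, ht, rfl⟩
    obtain ⟨a, s, hs, h⟩ := h b
    exact ⟨a, t * s, mul_mem ht hs, 1, one_mem _, by rw [map_mul, mul_assoc, h]⟩

end LocalizationMap

section

variable {A B : Type*} [CommRing A] [CommRing B] [Algebra A B]

/-- If `B` is flat over `A`, then an element of an `A`-module that dies in the base change to `B`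
is killed by some element outside any given prime contracted from `B`. -/
theorem Module.Flat.exists_smul_eq_zero_of_tmul_one_eq_zero [Module.Flat A B]
    {N : Type*} [AddCommGroup N] [Module A N] {n : N} (hn : n ⊗ₜ[A] (1 : B) = 0)
    (p : Ideal B) [p.IsPrime] :
    ∃ s ∈ (p.comap (algebraMap A B)).primeCompl, s • n = 0 := by
  obtain ⟨k, a, y, h₁, h₂⟩ :=
    TensorProduct.vanishesTrivially_of_sum_tmul_eq_zero_of_rTensor_injective A
      (m := fun _ : Unit ↦ n) (n := fun _ ↦ (1 : B))
      (Module.Flat.rTensor_preserves_injective_linearMap _ (Submodule.subtype_injective _))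
      (by simpa using hn)
  by_contra! h
  refine (Ideal.ne_top_iff_one p).mp (Ideal.IsPrime.ne_top inferInstance) ?_
  rw [show (1 : B) = _ from h₁ ()]
  refine Ideal.sum_mem _ fun j _ ↦ ?_
  rw [Algebra.smul_def]
  refine Ideal.mul_mem_right _ _ ?_
  by_contra hj
  exact h (a () j) hj (by simpa using h₂ j)

theorem Algebra.IsEpi.exists_algebraMap_mul_eq [Module.Flat A B] [Algebra.IsEpi A B]
    (p : Ideal B) [p.IsPrime] (b : B) :
    ∃ a, ∃ s ∈ (p.comap (algebraMap A B)).primeCompl,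
      algebraMap A B s * b = algebraMap A B a := by
  let π := (LinearMap.range (Algebra.linearMap A B)).mkQ
  have hb : π b ⊗ₜ[A] (1 : B) = 0 := by
    have := congrArg (π.rTensor B) ((Algebra.isEpi_iff_forall_one_tmul_eq A B).mp ‹_› b)
    rw [LinearMap.rTensor_tmul, LinearMap.rTensor_tmul] at this
    have h1 : π 1 = 0 := (Submodule.Quotient.mk_eq_zero _).mpr ⟨1, by simp⟩
    rw [← this, h1, zero_tmul]
  obtain ⟨s, hs, h⟩ := Module.Flat.exists_smul_eq_zero_of_tmul_one_eq_zero hb p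
  rw [← map_smul] at h
  obtain ⟨a, ha⟩ := (Submodule.Quotient.mk_eq_zero _).mp h
  exact ⟨a, s, hs, by rw [← Algebra.smul_def]; exact ha.symm⟩

theorem Module.Flat.exists_mul_eq_zero_of_algebraMap_eq_zero [Module.Flat A B]
    (p : Ideal B) [p.IsPrime] {a : A} (ha : algebraMap A B a = 0) :
    ∃ s ∈ (p.comap (algebraMap A B)).primeCompl, s * a = 0 := by
  refine Module.Flat.exists_smul_eq_zero_of_tmul_one_eq_zero (B := B) (n := a) ?_ p
  rw [← mul_one a, ← smul_eq_mul, smul_tmul, Algebra.smul_def, ha, zero_mul, tmul_zero]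

theorem PrimeSpectrum.comap_injective_of_exists_algebraMap_mul_eq
    (h : ∀ (p : Ideal B) [p.IsPrime], ∀ b, ∃ a, ∃ s ∈ (p.comap (algebraMap A B)).primeCompl,
      algebraMap A B s * b = algebraMap A B a) :
    Function.Injective (PrimeSpectrum.comap (algebraMap A B)) := by
  suffices H : ∀ p p' : PrimeSpectrum B, p.comap (algebraMap A B) = p'.comap (algebraMap A B) →
      p.asIdeal ≤ p'.asIdeal from
    fun p p' hp ↦ PrimeSpectrum.ext (le_antisymm (H p p' hp) (H p' p hp.symm))
  intro p p' hp b hb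
  have hp (x : A) : algebraMap A B x ∈ p.asIdeal ↔ algebraMap A B x ∈ p'.asIdeal :=
    SetLike.ext_iff.mp (PrimeSpectrum.ext_iff.mp hp) x
  obtain ⟨a, s, hs, h⟩ := h p.asIdeal b
  have ha := (hp a).mp (h ▸ Ideal.mul_mem_left _ _ hb)
  rw [← h] at ha
  exact (p'.isPrime.mem_or_mem ha).resolve_left fun hs' ↦ hs ((hp s).mpr hs')

theorem Localization.localRingHom_bijective_of_exists_mul_eq (p : Ideal B) [p.IsPrime]
    (hinj : ∀ a, algebraMap A B a = 0 →
      ∃ s ∈ (p.comap (algebraMap A B)).primeCompl, s * a = 0)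
    (hsurj : ∀ b, ∃ a, ∃ s ∈ (p.comap (algebraMap A B)).primeCompl,
      algebraMap A B s * b = algebraMap A B a) :
    Function.Bijective (Localization.localRingHom (p.comap (algebraMap A B)) p
      (algebraMap A B) rfl) := by
  have key (c : B) (hc : c ∈ p.primeCompl) :
      ∃ a ∈ (p.comap (algebraMap A B)).primeCompl,
        ∃ s ∈ (p.comap (algebraMap A B)).primeCompl,
          algebraMap A B s * c = algebraMap A B a := by
    obtain ⟨a, s, hs, h⟩ := hsurj c
    exact ⟨a, fun ha ↦ p.primeCompl.mul_mem hs hc (h ▸ ha), s, hs, h⟩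
  constructor
  · refine (IsLocalization.map_injective_iff _ _ _).mpr fun a c hc hca ↦ ?_
    obtain ⟨a', ha', s, -, h⟩ := key c hc
    obtain ⟨t, ht, hta⟩ := hinj (a' * a) (by rw [map_mul, ← h, mul_assoc, hca, mul_zero])
    exact ⟨t * a', mul_mem ht ha', by rw [mul_assoc, hta]⟩
  · refine (IsLocalization.map_surjective_iff _ _ _).mpr fun b d hd ↦ ?_
    obtain ⟨a, s, hs, h⟩ := hsurj b
    obtain ⟨a', ha', s', hs', h'⟩ := key d hd
    refine ⟨s' * a, a' * s, mul_mem ha' hs, 1, one_mem _, ?_⟩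
    rw [map_mul, map_mul, mul_assoc, h, ← h']
    ring

/-- If `Spec B → Spec A` is injective and `A_q → B_p` is bijective, where `q = p ∩ A`, then every
element outside `p` has a multiple in the image of `A \ q`. -/
theorem Localization.exists_mul_eq_algebraMap_of_localRingHom_bijective
    (hinj : Function.Injective (PrimeSpectrum.comap (algebraMap A B)))
    (p : Ideal B) [p.IsPrime]
    (hp : Function.Bijective (Localization.localRingHom (p.comap (algebraMap A B)) p
      (algebraMap A B) rfl))
    {c : B} (hc : c ∉ p) :
    ∃ d, ∃ s ∈ (p.comap (algebraMap A B)).primeCompl, d * c = algebraMap A B s := by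
  by_contra! h
  obtain ⟨p', hp', hcp', hdisj⟩ := Ideal.exists_le_prime_disjoint (Ideal.span {c})
    ((p.comap (algebraMap A B)).primeCompl.map (algebraMap A B)) (by
      rw [Set.disjoint_left]
      rintro _ hx ⟨s, hs, rfl⟩
      obtain ⟨d, hd⟩ := Ideal.mem_span_singleton'.mp hx
      exact h d s hs hd)
  set φ := Localization.localRingHom (p.comap (algebraMap A B)) p (algebraMap A B) rfl
  let q' := PrimeSpectrum.comap (algebraMap A B) ⟨p', hp'⟩
  have hq' : q' ∈ Set.range (PrimeSpectrum.comap
      (algebraMap A (Localization.AtPrime (p.comap (algebraMap A B))))) := by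
    rw [PrimeSpectrum.localization_comap_range _ (p.comap (algebraMap A B)).primeCompl]
    exact Set.disjoint_left.mpr fun s hs hsq ↦
      Set.disjoint_left.mp hdisj hsq ⟨s, hs, rfl⟩
  obtain ⟨Q, hQ⟩ := hq'
  let P := PrimeSpectrum.comap (RingEquiv.ofBijective φ hp).symm.toRingHom Q
  have hP : PrimeSpectrum.comap φ P = Q := by
    ext x
    change (RingEquiv.ofBijective φ hp).symm (RingEquiv.ofBijective φ hp x) ∈ Q.asIdeal ↔ _
    rw [RingEquiv.symm_apply_apply]
  let p'' := PrimeSpectrum.comap (algebraMap B (Localization.AtPrime p)) P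
  have hp'' : p'' = ⟨p', hp'⟩ := by
    apply hinj
    change _ = q'
    rw [← hQ, ← hP]
    ext x
    change algebraMap B _ (algebraMap A B x) ∈ P.asIdeal ↔ φ (algebraMap A _ x) ∈ P.asIdeal
    rw [Localization.localRingHom_to_map]
  have hc'' : c ∈ p''.asIdeal := by
    rw [hp'']
    exact hcp' (Ideal.mem_span_singleton_self c)
  exact P.isPrime.ne_top (Ideal.eq_top_of_isUnit_mem _ hc''
    (IsLocalization.map_units (Localization.AtPrime p) (⟨c, hc⟩ : p.primeCompl)))

theorem Module.Flat.of_localRingHom_bijective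
    (h : ∀ (p : Ideal B) [p.IsPrime], Function.Bijective
      (Localization.localRingHom (p.comap (algebraMap A B)) p (algebraMap A B) rfl)) :
    Module.Flat A B := by
  refine Module.flat_of_isLocalized_maximal (S := B) B (fun p _ ↦ Localization.AtPrime p)
    (fun p _ ↦ Algebra.linearMap B (Localization.AtPrime p)) fun p _ ↦ ?_
  let φ := Localization.localAlgHom (R := A) (p.comap (algebraMap A B)) p (Algebra.ofId A B) rfl
  have : Module.Flat A (Localization.AtPrime (p.comap (algebraMap A B))) :=
    IsLocalization.flat _ (p.comap (algebraMap A B)).primeCompl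
  exact Module.Flat.of_linearEquiv (AlgEquiv.ofBijective φ (h p)).toLinearEquiv.symm

theorem Algebra.IsEpi.of_exists_algebraMap_mul_eq
    (h : ∀ (p : Ideal B) [p.IsPrime], ∀ b, ∃ a, ∃ s ∈ (p.comap (algebraMap A B)).primeCompl,
      algebraMap A B s * b = algebraMap A B a) :
    Algebra.IsEpi A B := by
  rw [Algebra.isEpi_iff_forall_one_tmul_eq]
  intro b
  rw [← sub_eq_zero]
  set x : B ⊗[A] B := 1 ⊗ₜ b - b ⊗ₜ 1
  have hx : Ideal.torsionOf B (B ⊗[A] B) x = ⊤ := by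
    by_contra hne
    obtain ⟨m, hm, hle⟩ := Ideal.exists_le_maximal _ hne
    obtain ⟨a, s, hs, h⟩ := h m b
    refine hs (hle ?_)
    rw [Ideal.mem_torsionOf_iff, algebraMap_smul, smul_sub, ← tmul_smul, smul_tmul',
      Algebra.smul_def, h, Algebra.algebraMap_eq_smul_one, smul_tmul, sub_self]
  simpa using (Ideal.mem_torsionOf_iff x (1 : B)).mp (hx ▸ Submodule.mem_top)

end

/-- For a ring homomorphism `A → B` (encoded as an algebra), the following are
equivalent:
1. `B` is flat over `A` and the multiplication map `B ⊗[A] B → B` is an isomorphism;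
2. for every prime `p` of `B`, with `q = p ∩ A`, the natural map `A_q → B_q` (localization of `B`
   at the image of the multiplicative set `A \ q`) is an isomorphism;
3. `Spec B → Spec A` is injective and for every prime `p` of `B` the natural map
   `A_{p ∩ A} → B_p` is an isomorphism. -/
theorem flat_mul_iso_tfae {A B : Type*} [CommRing A] [CommRing B] [Algebra A B] :
    List.TFAE
      [ Module.Flat A B ∧ Function.Bijective (LinearMap.mul' A B),
        ∀ (p : Ideal B) [p.IsPrime],
          Function.Bijective
            (IsLocalization.map
              (S := Localization.AtPrime (Ideal.comap (algebraMap A B) p))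
              (T := Submonoid.map (algebraMap A B)
                (Ideal.comap (algebraMap A B) p).primeCompl)
              (Localization
                (Submonoid.map (algebraMap A B)
                  (Ideal.comap (algebraMap A B) p).primeCompl))
              (algebraMap A B) (Submonoid.le_comap_map _)),
        Function.Injective (PrimeSpectrum.comap (algebraMap A B)) ∧
          ∀ (p : Ideal B) [p.IsPrime],
            Function.Bijective
              (Localization.localRingHom (Ideal.comap (algebraMap A B) p) p
                (algebraMap A B) rfl) ] := by
  simp_rw [IsLocalization.map_bijective_iff_of_submonoid_map]
  tfae_have 1 → 2 := by
    rintro ⟨_, hmul⟩ p _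
    have : Algebra.IsEpi A B := ⟨hmul.1⟩
    exact ⟨fun a ↦ Module.Flat.exists_mul_eq_zero_of_algebraMap_eq_zero p,
      Algebra.IsEpi.exists_algebraMap_mul_eq p⟩
  tfae_have 2 → 3 := fun h ↦
    ⟨PrimeSpectrum.comap_injective_of_exists_algebraMap_mul_eq fun p _ ↦ (h p).2,
      fun p _ ↦ Localization.localRingHom_bijective_of_exists_mul_eq p (h p).1 (h p).2⟩
  tfae_have 3 → 2 := by
    rintro ⟨hinj, h⟩ p _
    refine ⟨fun a ha ↦ (IsLocalization.map_injective_iff _ _ _).mp (h p).1 a 1 (one_mem _)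
      (by rw [ha, mul_zero]), fun b ↦ ?_⟩
    obtain ⟨a, s, hs, c, hc, hcs⟩ :=
      (IsLocalization.map_surjective_iff _ _ _).mp (h p).2 b 1 (one_mem _)
    obtain ⟨d, t, ht, hd⟩ :=
      Localization.exists_mul_eq_algebraMap_of_localRingHom_bijective hinj p (h p) hc
    refine ⟨t * a, t * s, mul_mem ht hs, ?_⟩
    rw [map_mul, map_mul, ← hd, mul_assoc, mul_assoc, hcs, one_mul, mul_assoc]
  tfae_have 2 → 1 := fun h ↦
    ⟨.of_localRingHom_bijective fun p _ ↦
      Localization.localRingHom_bijective_of_exists_mul_eq p (h p).1 (h p).2,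
      (Algebra.IsEpi.of_exists_algebraMap_mul_eq fun p _ ↦ (h p).2).injective_lift_mul,
      fun b ↦ ⟨b ⊗ₜ 1, by simp⟩⟩
  tfae_finish
end

section
/- Let X be an affine finite space, M a quasi-coherent O_X-module, V ⊆ X any open subset and U ⊆ X an affine open subset. Then the natural morphism M(V) ⊗_{O(X)} O(U) → M(U ∩ V) is an isomorphism. -/
open scoped TensorProduct

set_option maxHeartbeats 1000000
set_option synthInstance.maxHeartbeats 400000

/-- A finite ringed space, encoded combinatorially: a finite preordered set `X` (the topology is
the Alexandrov topology whose open sets are the upper sets, and `U_x = Set.Ici x` is the minimal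
open neighbourhood of `x`), a commutative ring `O x` at each point (the stalk,
`O x = O(U_x)`), and compatible restriction ring homomorphisms. -/
structure FRS : Type 1 where
  X : Type
  [fin : Finite X]
  [ord : Preorder X]
  O : X → Type
  [ring : ∀ x, CommRing (O x)]
  res : ∀ {x y : X}, x ≤ y → O x →+* O y
  res_refl : ∀ x : X, res (le_refl x) = RingHom.id (O x)
  res_trans : ∀ {x y z : X} (h₁ : x ≤ y) (h₂ : y ≤ z),
      (res h₂).comp (res h₁) = res (h₁.trans h₂)

attribute [instance] FRS.fin FRS.ord FRS.ring

namespace FRS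

variable (S : FRS)

/-- The sections of the structure sheaf over a subset `U` (intended: an open, i.e. upper, set):
compatible families of stalk elements. -/
def sect (U : Set S.X) : Subring (∀ z : U, S.O z.1) where
  carrier := { s | ∀ ⦃z w : U⦄ (h : z.1 ≤ w.1), S.res h (s z) = s w }
  zero_mem' := by intro z w h; simp
  one_mem' := by intro z w h; simp
  add_mem' := by
    intro a b ha hb z w h
    simp only [Pi.add_apply, map_add, ha h, hb h]
  mul_mem' := by
    intro a b ha hb z w h
    simp only [Pi.mul_apply, map_mul, ha h, hb h]
  neg_mem' := by
    intro a ha z w h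
    simp only [Pi.neg_apply, map_neg, ha h]

/-- The ring of sections over `U`. -/
abbrev Gamma (U : Set S.X) : Type := ↥(S.sect U)

/-- Evaluation of a section at a point of `U` (restriction to the stalk). -/
def ev {U : Set S.X} (x : S.X) (hx : x ∈ U) : S.Gamma U →+* S.O x :=
  (Pi.evalRingHom _ (⟨x, hx⟩ : U)).comp (S.sect U).subtype

/-- Restriction of global sections to the stalk at `x`. -/
def toStalk (x : S.X) : S.Gamma Set.univ →+* S.O x :=
  S.ev x (Set.mem_univ x)

/-- The canonical morphism `O(X) → ∏ₓ O_x`. -/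
def toProd : S.Gamma Set.univ →+* ∀ x : S.X, S.O x :=
  Pi.ringHom fun x => S.toStalk x

/-- Restriction of sections along an inclusion of subsets. -/
def resSect {U V : Set S.X} (h : V ⊆ U) : S.Gamma U →+* S.Gamma V where
  toFun s := ⟨fun z => (s : ∀ z : U, S.O z.1) ⟨z.1, h z.2⟩,
    fun z w hzw => s.2 (z := ⟨z.1, h z.2⟩) (w := ⟨w.1, h w.2⟩) hzw⟩
  map_one' := rfl
  map_mul' _ _ := rfl
  map_zero' := rfl
  map_add' _ _ := rfl

/-- The canonical map from the stalk at `x` to the sections over a subset of `U_x = Ici x`. -/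
def stalkSect {x : S.X} {U : Set S.X} (hU : U ⊆ Set.Ici x) : S.O x →+* S.Gamma U where
  toFun a := ⟨fun z => S.res (hU z.2) a, by
    intro z w h
    have := RingHom.congr_fun (S.res_trans (hU z.2) h) a
    simpa using this⟩
  map_one' := by ext z; simp
  map_mul' a b := by ext z; simp
  map_zero' := by ext z; simp
  map_add' a b := by ext z; simp

/-- The canonical morphism `O(U) → ∏_{z ∈ U} O_z`. -/
def sectToProd (U : Set S.X) : S.Gamma U →+* ∀ z : U, S.O z.1 :=
  (S.sect U).subtype

/-- Each stalk is an algebra over the ring of global sections. -/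
noncomputable instance globAlgebra (x : S.X) : Algebra (S.Gamma Set.univ) (S.O x) :=
  (S.toStalk x).toAlgebra

/-- The sections over any subset form an algebra over the ring of global sections. -/
noncomputable instance gammaAlgebra (U : Set S.X) :
    Algebra (S.Gamma Set.univ) (S.Gamma U) :=
  (S.resSect (Set.subset_univ U)).toAlgebra

end FRS

/-- A ring homomorphism is faithfully flat if it makes the target into a faithfully flat module
over the source. -/
def RingHom.IsFaithfullyFlatHom {A B : Type*} [CommRing A] [CommRing B] (f : A →+* B) : Prop :=
  @Module.FaithfullyFlat A B _ _ (Module.compHom B f)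

/-- A ring homomorphism is flat if it makes the target into a flat module over the source. -/
def RingHom.IsFlatHom {A B : Type*} [CommRing A] [CommRing B] (f : A →+* B) : Prop :=
  @Module.Flat A B _ _ (Module.compHom B f)

namespace FRS

variable (S : FRS)

/-- `X` is an affine finite space: (1) `O(X) → ∏ₓ O_x` is faithfully flat; (2) the natural map
`O_x ⊗_{O(X)} O_y → O(U_x ∩ U_y)` (characterized on simple tensors) is an isomorphism;
(3) `O(U_x ∩ U_y) → ∏_{z ∈ U_x ∩ U_y} O_z` is faithfully flat. -/
def IsAffine : Prop :=
  S.toProd.IsFaithfullyFlatHom ∧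
  (∀ x y : S.X,
    ∀ ψ : ((S.O x) ⊗[S.Gamma Set.univ] (S.O y)) →+* S.Gamma (Set.Ici x ∩ Set.Ici y),
      (∀ (a : S.O x) (b : S.O y) (z : ↥(Set.Ici x ∩ Set.Ici y)),
        ((ψ (a ⊗ₜ b)) : ∀ w : ↥(Set.Ici x ∩ Set.Ici y), S.O w.1) z
          = S.res z.2.1 a * S.res z.2.2 b) →
      Function.Bijective ψ) ∧
  (∀ x y : S.X, (S.sectToProd (Set.Ici x ∩ Set.Ici y)).IsFaithfullyFlatHom)

/-- The open (= upper) subset `U`, as a finite ringed space in its own right. -/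
noncomputable def restrict (U : Set S.X) : FRS where
  X := ↥U
  fin := inferInstance
  ord := inferInstance
  O := fun u => S.O u.1
  ring := fun _ => inferInstance
  res := fun h => S.res h
  res_refl := fun u => S.res_refl u.1
  res_trans := fun h₁ h₂ => S.res_trans h₁ h₂

/-- An affine open subset. -/
def IsAffineOpen (U : Set S.X) : Prop :=
  IsUpperSet U ∧ (S.restrict U).IsAffine

/-- A schematic finite space: every minimal open set `U_x` is affine. -/
def IsSchematic : Prop :=
  ∀ x : S.X, (S.restrict (Set.Ici x)).IsAffine

end FRS
namespace FRS

/-- A sheaf of `O`-modules on a finite ringed space, given stalkwise: an `O_x`-module `M x` for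
each point, with additive restriction maps that are semilinear with respect to the ring
restrictions. -/
structure Mod (S : FRS) : Type 1 where
  M : S.X → Type
  [ab : ∀ x, AddCommGroup (M x)]
  [mod : ∀ x, Module (S.O x) (M x)]
  res : ∀ {x y : S.X}, x ≤ y → M x →+ M y
  res_smul : ∀ {x y : S.X} (h : x ≤ y) (a : S.O x) (m : M x),
      res h (a • m) = S.res h a • res h m
  res_refl : ∀ (x : S.X) (m : M x), res (le_refl x) m = m
  res_trans : ∀ {x y z : S.X} (h₁ : x ≤ y) (h₂ : y ≤ z) (m : M x),
      res h₂ (res h₁ m) = res (h₁.trans h₂) m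

attribute [instance] Mod.ab Mod.mod

variable {S : FRS}

/-- A module sheaf `M` is quasi-coherent iff for all `x ≤ y` the natural map
`M_x ⊗_{O_x} O_y → M_y`, `m ⊗ b ↦ b • (res m)` (characterized here on simple tensors),
is an isomorphism. -/
def Mod.IsQcoh (M : S.Mod) : Prop :=
  ∀ ⦃x y : S.X⦄ (h : x ≤ y),
    letI : Module (S.O x) (S.O y) := Module.compHom _ (S.res h)
    ∀ ψ : (TensorProduct (S.O x) (M.M x) (S.O y)) →+ M.M y,
      (∀ (m : M.M x) (b : S.O y), ψ (m ⊗ₜ[S.O x] b) = b • M.res h m) →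
      Function.Bijective ψ

end FRS
namespace FRS

variable {S : FRS}

noncomputable instance Mod.ambientModule (M : S.Mod) (U : Set S.X) :
    Module (S.Gamma Set.univ) (∀ z : U, M.M z.1) :=
  Module.compHom _ ((S.sectToProd U).comp (S.resSect (Set.subset_univ U)))

/-- The sections of a module sheaf over a subset `U`, as a module over the global sections of the
structure sheaf. -/
noncomputable def Mod.sect (M : S.Mod) (U : Set S.X) :
    Submodule (S.Gamma Set.univ) (∀ z : U, M.M z.1) where
  carrier := { s | ∀ ⦃z w : U⦄ (h : z.1 ≤ w.1), M.res h (s z) = s w }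
  zero_mem' := by intro z w h; simp
  add_mem' := by
    intro a b ha hb z w h
    simp [map_add, ha h, hb h]
  smul_mem' := by
    intro r s hs z w h
    show M.res h (S.toStalk z.1 r • s z) = S.toStalk w.1 r • s w
    rw [M.res_smul, hs h]
    congr 1
    exact r.2 (z := ⟨z.1, trivial⟩) (w := ⟨w.1, trivial⟩) h

end FRS

open TensorProduct in
theorem TensorProduct.piRightHom_apply_eq_lTensor {R D V : Type*} [CommRing R] [AddCommGroup D]
    [Module R D] (F : V → Type*) [∀ v, AddCommGroup (F v)] [∀ v, Module R (F v)]
    (t : D ⊗[R] (∀ v, F v)) (v : V) :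
    piRightHom R R D F t v = (LinearMap.proj (R := R) (φ := F) v).lTensor D t := by
  induction t with
  | zero => simp
  | tmul d f => simp
  | add a b ha hb => simp [ha, hb]

open TensorProduct in
theorem TensorProduct.eq_of_lTensor_proj {R D V : Type*} [CommRing R] [AddCommGroup D]
    [Module R D] [Finite V] {F : V → Type*} [∀ v, AddCommGroup (F v)] [∀ v, Module R (F v)]
    {t s : D ⊗[R] (∀ v, F v)}
    (h : ∀ v, (LinearMap.proj (R := R) (φ := F) v).lTensor D t =
      (LinearMap.proj (R := R) (φ := F) v).lTensor D s) : t = s := by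
  classical
  have := Fintype.ofFinite V
  apply (piRight R R D F).injective
  ext v
  simpa [piRightHom_apply_eq_lTensor] using h v

open TensorProduct in
theorem TensorProduct.exists_lTensor_proj_eq {R D V : Type*} [CommRing R] [AddCommGroup D]
    [Module R D] [Finite V] {F : V → Type*} [∀ v, AddCommGroup (F v)] [∀ v, Module R (F v)]
    (t : ∀ v, D ⊗[R] F v) :
    ∃ s : D ⊗[R] (∀ v, F v), ∀ v, (LinearMap.proj (R := R) (φ := F) v).lTensor D s = t v := by
  classical
  have := Fintype.ofFinite V
  obtain ⟨s, hs⟩ := (piRight R R D F).surjective t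
  refine ⟨s, fun v => ?_⟩
  rw [← hs, piRight_apply, piRightHom_apply_eq_lTensor]

/-- `P`, with the maps `ε`, is the module of compatible families of the diagram `(F, r)`. -/
structure IsModuleOfSections {R V : Type*} [CommRing R] [LE V] {F : V → Type*}
    [∀ v, AddCommGroup (F v)] [∀ v, Module R (F v)] (r : ∀ ⦃v w : V⦄, v ≤ w → F v →ₗ[R] F w)
    {P : Type*} [AddCommGroup P] [Module R P] (ε : ∀ v, P →ₗ[R] F v) : Prop where
  compat : ∀ ⦃v w : V⦄ (h : v ≤ w) (p : P), r h (ε v p) = ε w p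
  eq_zero : ∀ p : P, (∀ v, ε v p = 0) → p = 0
  exists_lift : ∀ t : ∀ v, F v, (∀ ⦃v w : V⦄ (h : v ≤ w), r h (t v) = t w) →
    ∃ p, ∀ v, ε v p = t v

/-- Taking sections over a finite diagram commutes with flat base change. -/
theorem IsModuleOfSections.lTensor {R V : Type*} [CommRing R] [LE V] [Finite V] {F : V → Type*}
    [∀ v, AddCommGroup (F v)] [∀ v, Module R (F v)] {r : ∀ ⦃v w : V⦄, v ≤ w → F v →ₗ[R] F w}
    {P : Type*} [AddCommGroup P] [Module R P] {ε : ∀ v, P →ₗ[R] F v}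
    (hε : IsModuleOfSections r ε) (D : Type*) [AddCommGroup D] [Module R D] [Module.Flat R D] :
    IsModuleOfSections (fun _ _ h => (r h).lTensor D) (fun v => (ε v).lTensor D) := by
  let δ : (∀ v, F v) →ₗ[R] ∀ p : {p : V × V // p.1 ≤ p.2}, F p.1.2 :=
    LinearMap.pi fun p => r p.2 ∘ₗ LinearMap.proj p.1.1 - LinearMap.proj p.1.2
  have hproj (v : V) : LinearMap.proj v ∘ₗ LinearMap.pi ε = ε v := by ext; simp
  have hexact : Function.Exact (LinearMap.pi ε) δ := by
    intro t
    constructor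
    · intro ht
      obtain ⟨p, hp⟩ := hε.exists_lift t fun v w h => by
        simpa [δ, sub_eq_zero] using congrFun ht ⟨(v, w), h⟩
      exact ⟨p, funext hp⟩
    · rintro ⟨p, rfl⟩
      ext ⟨⟨v, w⟩, h⟩
      simp [δ, hε.compat h]
  have hinj : Function.Injective (LinearMap.pi ε) :=
    (injective_iff_map_eq_zero _).2 fun p hp => hε.eq_zero p (congrFun hp)
  refine ⟨fun v w h p => ?_, fun p hp => ?_, fun t ht => ?_⟩
  · have : r h ∘ₗ ε v = ε w := LinearMap.ext (hε.compat h)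
    rw [← LinearMap.lTensor_comp_apply, this]
  · apply Module.Flat.lTensor_preserves_injective_linearMap (M := D) _ hinj
    rw [map_zero]
    apply TensorProduct.eq_of_lTensor_proj
    intro v
    rw [← LinearMap.lTensor_comp_apply, hproj, hp, map_zero]
  · obtain ⟨s, hs⟩ := TensorProduct.exists_lTensor_proj_eq t
    obtain ⟨p, hp⟩ := (Module.Flat.lTensor_exact D hexact s).1 <| by
      apply TensorProduct.eq_of_lTensor_proj
      rintro ⟨⟨v, w⟩, h⟩
      have : LinearMap.proj (⟨(v, w), h⟩ : {p : V × V // p.1 ≤ p.2}) ∘ₗ δ =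
        r h ∘ₗ LinearMap.proj v - LinearMap.proj w := rfl
      rw [← LinearMap.lTensor_comp_apply, this, LinearMap.lTensor_sub, LinearMap.sub_apply,
        LinearMap.lTensor_comp_apply, hs, hs, ht h, sub_self, map_zero]
    refine ⟨p, fun v => ?_⟩
    rw [← hs v, ← hp, ← LinearMap.lTensor_comp_apply, hproj]

/-- A factor of a flat finite product of modules is flat. -/
theorem Module.Flat.of_pi {R W : Type*} [CommRing R] (D : W → Type*)
    [∀ z, AddCommGroup (D z)] [∀ z, Module R (D z)] [Module.Flat R (∀ z, D z)] (z : W) :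
    Module.Flat R (D z) := by
  classical
  exact .of_retract (LinearMap.single R D z) (LinearMap.proj z) (by ext; simp)

/-- Bijectivity can be checked after tensoring with the factors of a faithfully flat product. -/
theorem Module.FaithfullyFlat.bijective_of_pi {R W : Type*} [CommRing R] [Finite W] (D : W → Type*)
    [∀ z, AddCommGroup (D z)] [∀ z, Module R (D z)] [Module.FaithfullyFlat R (∀ z, D z)]
    {N P : Type*} [AddCommGroup N] [Module R N] [AddCommGroup P] [Module R P] (φ : N →ₗ[R] P)
    (h : ∀ z, Function.Bijective (φ.lTensor (D z))) : Function.Bijective φ := by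
  classical
  have := Fintype.ofFinite W
  rw [← Module.FaithfullyFlat.lTensor_bijective_iff_bijective R (∀ z, D z)]
  have hsq : TensorProduct.piLeft R P D ∘ₗ φ.lTensor (∀ z, D z) =
      LinearMap.pi (fun z => φ.lTensor (D z) ∘ₗ LinearMap.proj z) ∘ₗ
        (TensorProduct.piLeft R N D).toLinearMap := by
    apply TensorProduct.ext'
    intro d n
    ext z
    simp
  have hbij : Function.Bijective
      (LinearMap.pi (fun z => φ.lTensor (D z) ∘ₗ LinearMap.proj z) ∘ₗ
        (TensorProduct.piLeft R N D).toLinearMap) := by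
    rw [LinearMap.coe_comp]
    exact (Function.Bijective.piMap h).comp (TensorProduct.piLeft R N D).bijective
  rw [← hsq, LinearMap.coe_comp] at hbij
  exact (Function.Bijective.of_comp_iff' (TensorProduct.piLeft R P D).bijective _).1 hbij

/-- A module whose base changes to the members `D z` of a faithfully flat cover are the `F z` is
the module of sections of the diagram `F`. -/
theorem IsModuleOfSections.of_isBaseChange (A : Type*) {B W : Type*} [CommRing A] [CommRing B]
    [Algebra A B] [Finite W] [Preorder W] (D : W → Type*) [∀ z, CommRing (D z)]
    [∀ z, Algebra A (D z)] [∀ z, Algebra B (D z)] [∀ z, IsScalarTower A B (D z)]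
    [Module.FaithfullyFlat B (∀ z, D z)] {F : W → Type*} [∀ z, AddCommGroup (F z)]
    [∀ z, Module A (F z)] [∀ z, Module B (F z)] [∀ z, Module (D z) (F z)]
    [∀ z, IsScalarTower A B (F z)] [∀ z, IsScalarTower B (D z) (F z)]
    (e : ∀ ⦃z w : W⦄, z ≤ w → D z →ₐ[B] D w) (r : ∀ ⦃z w : W⦄, z ≤ w → F z →ₗ[B] F w)
    (hr : ∀ ⦃z w : W⦄ (h : z ≤ w) (d : D z) (f : F z), r h (d • f) = e h d • r h f)
    (hinj : ∀ (y z : W) (τ : D z ⊗[A] F y),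
      (∀ (w : W) (hy : y ≤ w) (hz : z ≤ w) (θ : D z ⊗[A] F y →+ F w),
        (∀ d f, θ (d ⊗ₜ f) = e hz d • r hy f) → θ τ = 0) → τ = 0)
    {N : Type*} [AddCommGroup N] [Module B N] (φ : ∀ z, N →ₗ[B] F z)
    (hφ : ∀ ⦃z w : W⦄ (h : z ≤ w) (n : N), r h (φ z n) = φ w n)
    (hbc : ∀ z, IsBaseChange (D z) (φ z)) : IsModuleOfSections r φ := by
  let G : Submodule B (∀ z, F z) :=
    { carrier := {t | ∀ ⦃z w : W⦄ (h : z ≤ w), r h (t z) = t w}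
      zero_mem' := fun z w h => by simp
      add_mem' := fun {a b} ha hb z w h => by simp [ha h, hb h]
      smul_mem' := fun c a ha z w h => by simp [ha h] }
  let ε (z : W) : G →ₗ[B] F z := LinearMap.proj z ∘ₗ G.subtype
  have hG : IsModuleOfSections r ε :=
    ⟨fun v w h p => p.2 h, fun p hp => Subtype.ext (funext hp), fun t ht => ⟨⟨t, ht⟩, fun _ => rfl⟩⟩
  let φ' : N →ₗ[B] G := (LinearMap.pi φ).codRestrict G fun n z w h => hφ h n
  have hφ' : Function.Bijective φ' := by
    apply Module.FaithfullyFlat.bijective_of_pi D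
    intro z
    have := Module.Flat.of_pi (R := B) D z
    let g : D z ⊗[B] G →ₗ[D z] F z := (ε z).liftBaseChange (D z)
    have hcomp : g ∘ φ'.lTensor (D z) = (hbc z).equiv := by
      funext t
      induction t with
      | zero => simp
      | tmul d n =>
        simp [g, ε, IsBaseChange.equiv_tmul]
        rfl
      | add a b ha hb => simpa using congrArg₂ (· + ·) ha hb
    have hg : Function.Injective g := by
      refine (injective_iff_map_eq_zero g).2 fun t ht => (hG.lTensor (D z)).eq_zero t fun y => ?_
      obtain ⟨τ, hτ⟩ :=
        TensorProduct.mapOfCompatibleSMul_surjective B A A (D z) (F y) ((ε y).lTensor (D z) t)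
      suffices τ = 0 by rw [← hτ, this, map_zero]
      refine hinj y z τ fun w hy hz θ hθ => ?_
      let θB : D z ⊗[B] F y →ₗ[B] F w := TensorProduct.lift <|
        LinearMap.mk₂ B (fun d f => e hz d • r hy f) (by simp [add_smul]) (by simp)
          (by simp) (fun c d f => by rw [map_smul, smul_algebra_smul_comm])
      have hθB (τ : D z ⊗[A] F y) :
          θ τ = θB (TensorProduct.mapOfCompatibleSMul B A A (D z) (F y) τ) := by
        induction τ with
        | zero => simp
        | tmul d f => simp [hθ, θB]
        | add a b ha hb => simp [ha, hb]
      have hgθ (t : D z ⊗[B] G) : θB ((ε y).lTensor (D z) t) = r hz (g t) := by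
        induction t with
        | zero => simp
        | tmul d s => simp [θB, g, hr, hG.compat]
        | add a b ha hb => simp [ha, hb]
      rw [hθB, hτ, hgθ, ht, map_zero]
    have hbij : Function.Bijective (g ∘ φ'.lTensor (D z)) := hcomp ▸ (hbc z).equiv.bijective
    exact ⟨hbij.1.of_comp, fun t => by
      obtain ⟨s, hs⟩ := hbij.2 (g t)
      exact ⟨s, hg hs⟩⟩
  refine ⟨hφ, fun n hn => hφ'.1 ?_, fun t ht => ?_⟩
  · rw [map_zero]
    exact Subtype.ext (funext hn)
  · obtain ⟨n, hn⟩ := hφ'.2 ⟨t, ht⟩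
    exact ⟨n, congrFun (congrArg Subtype.val hn)⟩

/-- An element whose images in the base changes to a faithfully flat cover vanish is zero. -/
theorem IsBaseChange.eq_zero_of_faithfullyFlat_pi {B W : Type*} [CommRing B] [Finite W]
    (D : W → Type*) [∀ z, CommRing (D z)] [∀ z, Algebra B (D z)]
    [Module.FaithfullyFlat B (∀ z, D z)] {F : W → Type*} [∀ z, AddCommGroup (F z)]
    [∀ z, Module B (F z)] [∀ z, Module (D z) (F z)] [∀ z, IsScalarTower B (D z) (F z)]
    {N : Type*} [AddCommGroup N] [Module B N] {φ : ∀ z, N →ₗ[B] F z}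
    (hbc : ∀ z, IsBaseChange (D z) (φ z)) {n : N} (hn : ∀ z, φ z n = 0) : n = 0 := by
  classical
  have := Fintype.ofFinite W
  rw [← Module.FaithfullyFlat.one_tmul_eq_zero_iff B N (A := ∀ z, D z)]
  apply (TensorProduct.piLeft B N D).injective
  ext z
  apply (hbc z).equiv.injective
  simp [IsBaseChange.equiv_tmul, hn]

section Pushout

theorem IsBaseChange.liftBaseChange_of_tower {R B D M F : Type*} [CommRing R] [CommRing B]
    [CommRing D] [Algebra R B] [Algebra R D] [Algebra B D] [IsScalarTower R B D]
    [AddCommGroup M] [Module R M] [AddCommGroup F] [Module R F] [Module B F] [Module D F]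
    [IsScalarTower R B F] [IsScalarTower R D F] [IsScalarTower B D F] {f : M →ₗ[R] F}
    (hf : IsBaseChange D f) : IsBaseChange D (f.liftBaseChange B) := by
  apply IsBaseChange.of_comp (TensorProduct.isBaseChange R M B)
  convert hf
  ext m
  simp

variable {A R₀ R₁ B : Type*} [CommRing A] [CommRing R₀] [CommRing R₁] [CommRing B]
  [Algebra A R₀] [Algebra A R₁] [Algebra A B] [Algebra R₀ B] [Algebra R₁ B]
  [IsScalarTower A R₀ B] [IsScalarTower A R₁ B] [Algebra.IsPushout A R₁ R₀ B]
  {M₀ : Type*} [AddCommGroup M₀] [Module A M₀] [Module R₀ M₀] [IsScalarTower A R₀ M₀]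

theorem Algebra.IsPushout.map_eq_liftBaseChange {F : Type*} [AddCommGroup F] [Module R₀ F]
    [Module B F] [IsScalarTower R₀ B F] {f : M₀ →ₗ[R₀] F} {θ : R₁ ⊗[A] M₀ →+ F}
    (hθ : ∀ a m, θ (a ⊗ₜ m) = algebraMap R₁ B a • f m) (τ : R₁ ⊗[A] M₀) :
    θ τ = f.liftBaseChange B ((Algebra.IsPushout.cancelBaseChange A R₁ R₀ B M₀).symm τ) := by
  induction τ with
  | zero => simp
  | tmul a m => simp [hθ]
  | add a b ha hb => simp [ha, hb]

variable {W : Type*} [Finite W] {D : W → Type*} [∀ w, CommRing (D w)] [∀ w, Algebra B (D w)]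
  [∀ w, Algebra R₀ (D w)] [∀ w, IsScalarTower R₀ B (D w)] [Module.FaithfullyFlat B (∀ w, D w)]
  {F : W → Type*} [∀ w, AddCommGroup (F w)] [∀ w, Module R₀ (F w)] [∀ w, Module B (F w)]
  [∀ w, Module (D w) (F w)] [∀ w, IsScalarTower R₀ B (F w)] [∀ w, IsScalarTower R₀ (D w) (F w)]
  [∀ w, IsScalarTower B (D w) (F w)] {f : ∀ w, M₀ →ₗ[R₀] F w}

theorem Algebra.IsPushout.eq_zero_of_isBaseChange (hf : ∀ w, IsBaseChange (D w) (f w))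
    {θ : ∀ w, R₁ ⊗[A] M₀ →+ F w}
    (hθ : ∀ w a m, θ w (a ⊗ₜ m) = algebraMap R₁ B a • f w m) {τ : R₁ ⊗[A] M₀}
    (hτ : ∀ w, θ w τ = 0) : τ = 0 := by
  apply (Algebra.IsPushout.cancelBaseChange A R₁ R₀ B M₀).symm.injective
  rw [map_zero]
  exact IsBaseChange.eq_zero_of_faithfullyFlat_pi D (fun w => (hf w).liftBaseChange_of_tower)
    fun w => by rw [← map_eq_liftBaseChange (hθ w), hτ]

theorem Algebra.IsPushout.exists_lift_of_isBaseChange [Preorder W]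
    [∀ w, Algebra A (D w)] [∀ w, IsScalarTower A B (D w)] [∀ w, Module A (F w)]
    [∀ w, IsScalarTower A B (F w)]
    (hf : ∀ w, IsBaseChange (D w) (f w)) {θ : ∀ w, R₁ ⊗[A] M₀ →+ F w}
    (hθ : ∀ w a m, θ w (a ⊗ₜ m) = algebraMap R₁ B a • f w m)
    (e : ∀ ⦃z w : W⦄, z ≤ w → D z →ₐ[B] D w) (r : ∀ ⦃z w : W⦄, z ≤ w → F z →ₗ[B] F w)
    (hr : ∀ ⦃z w : W⦄ (h : z ≤ w) (d : D z) (f : F z), r h (d • f) = e h d • r h f)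
    (hrf : ∀ ⦃z w : W⦄ (h : z ≤ w) (m : M₀), r h (f z m) = f w m)
    (hinj : ∀ (y z : W) (τ : D z ⊗[A] F y),
      (∀ (w : W) (hy : y ≤ w) (hz : z ≤ w) (θ : D z ⊗[A] F y →+ F w),
        (∀ d f, θ (d ⊗ₜ f) = e hz d • r hy f) → θ τ = 0) → τ = 0)
    {t : ∀ w, F w} (ht : ∀ ⦃z w : W⦄ (h : z ≤ w), r h (t z) = t w) :
    ∃ τ, ∀ w, θ w τ = t w := by
  have h := IsModuleOfSections.of_isBaseChange A D e r hr hinj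
    (fun w => (f w).liftBaseChange B) (fun z w h n => ?_)
    (fun w => (hf w).liftBaseChange_of_tower)
  · obtain ⟨n, hn⟩ := h.exists_lift t ht
    refine ⟨Algebra.IsPushout.cancelBaseChange A R₁ R₀ B M₀ n, fun w => ?_⟩
    rw [map_eq_liftBaseChange (hθ w), LinearEquiv.symm_apply_apply, hn]
  · induction n with
    | zero => simp
    | tmul b m => simp [hrf]
    | add a b ha hb => simp only [map_add, ha, hb]

end Pushout

namespace FRS

variable {S : FRS}

theorem res_toStalk {x y : S.X} (h : x ≤ y) (a : S.Gamma Set.univ) :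
    S.res h (S.toStalk x a) = S.toStalk y a :=
  a.2 (z := ⟨x, trivial⟩) (w := ⟨y, trivial⟩) h

theorem res_res {x y z : S.X} (h₁ : x ≤ y) (h₂ : y ≤ z) (a : S.O x) :
    S.res h₂ (S.res h₁ a) = S.res (h₁.trans h₂) a :=
  RingHom.congr_fun (S.res_trans h₁ h₂) a

theorem IsAffine.flat_stalk (hS : S.IsAffine) (x : S.X) :
    Module.Flat (S.Gamma Set.univ) (S.O x) := by
  have : Module.FaithfullyFlat (S.Gamma Set.univ) (∀ x, S.O x) := hS.1
  exact Module.Flat.of_pi S.O x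

namespace Mod

variable (M : S.Mod)

noncomputable instance stalkModule (x : S.X) : Module (S.Gamma Set.univ) (M.M x) :=
  Module.compHom _ (S.toStalk x)

instance (x : S.X) : IsScalarTower (S.Gamma Set.univ) (S.O x) (M.M x) :=
  ⟨fun a b m => mul_smul (S.toStalk x a) b m⟩

/-- The restriction of a module sheaf to a larger point, as a linear map over global sections. -/
noncomputable def resₗ {x y : S.X} (h : x ≤ y) : M.M x →ₗ[S.Gamma Set.univ] M.M y :=
  { M.res h with
    map_smul' := fun a m => by
      change M.res h (S.toStalk x a • m) = S.toStalk y a • M.res h m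
      rw [M.res_smul, res_toStalk] }

/-- The natural map `O_z ⊗ M_y → M_w` for `y, z ≤ w`. -/
noncomputable def tensorStalk {y z w : S.X} (hy : y ≤ w) (hz : z ≤ w) :
    S.O z ⊗[S.Gamma Set.univ] M.M y →ₗ[S.Gamma Set.univ] M.M w :=
  TensorProduct.lift <| LinearMap.mk₂ _ (fun d m => S.res hz d • M.res hy m)
    (by simp [add_smul])
    (fun a d m => by
      rw [Algebra.smul_def, map_mul, mul_smul]
      exact congrArg (· • _) (res_toStalk hz a))
    (by simp)
    (fun a d m => by
      change _ • M.resₗ hy (a • m) = a • _ • M.resₗ hy m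
      rw [map_smul, smul_algebra_smul_comm])

@[simp]
theorem tensorStalk_tmul {y z w : S.X} (hy : y ≤ w) (hz : z ≤ w) (d : S.O z) (m : M.M y) :
    M.tensorStalk hy hz (d ⊗ₜ m) = S.res hz d • M.res hy m := rfl

end Mod

/-- The restriction maps of a quasi-coherent module sheaf are base changes. -/
theorem Mod.IsQcoh.isBaseChange {M : S.Mod} (hM : M.IsQcoh) {x y : S.X} (h : x ≤ y)
    [Algebra (S.O x) (S.O y)] [Module (S.O x) (M.M y)] [IsScalarTower (S.O x) (S.O y) (M.M y)]
    (halg : algebraMap (S.O x) (S.O y) = S.res h) (f : M.M x →ₗ[S.O x] M.M y)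
    (hf : ∀ m, f m = M.res h m) : IsBaseChange (S.O y) f := by
  have hmod : (Module.compHom _ (S.res h) : Module (S.O x) (S.O y)) = Algebra.toModule := by
    ext a b
    exact (congrArg (· * b) (RingHom.congr_fun halg a)).symm.trans (Algebra.smul_def a b).symm
  have key := hM h
  rw [hmod] at key
  have hb := key (((f.liftBaseChange (S.O y)).toAddMonoidHom).comp
    (TensorProduct.comm (S.O x) (M.M x) (S.O y)).toLinearMap.toAddMonoidHom) fun m b => by
      simp [hf]
  have hb' : Function.Bijective (f.liftBaseChange (S.O y)) :=
    (Function.Bijective.of_comp_iff _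
      (TensorProduct.comm (S.O x) (M.M x) (S.O y)).bijective).1 hb
  exact IsBaseChange.of_equiv (LinearEquiv.ofBijective _ hb') (by simp)

theorem IsAffine.isPushout (hS : S.IsAffine) (x y : S.X)
    [Algebra (S.O x) (S.Gamma (Set.Ici x ∩ Set.Ici y))]
    [Algebra (S.O y) (S.Gamma (Set.Ici x ∩ Set.Ici y))]
    [IsScalarTower (S.Gamma Set.univ) (S.O x) (S.Gamma (Set.Ici x ∩ Set.Ici y))]
    [IsScalarTower (S.Gamma Set.univ) (S.O y) (S.Gamma (Set.Ici x ∩ Set.Ici y))]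
    (hx : algebraMap (S.O x) (S.Gamma (Set.Ici x ∩ Set.Ici y)) =
      S.stalkSect Set.inter_subset_left)
    (hy : algebraMap (S.O y) (S.Gamma (Set.Ici x ∩ Set.Ici y)) =
      S.stalkSect Set.inter_subset_right) :
    Algebra.IsPushout (S.Gamma Set.univ) (S.O x) (S.O y)
      (S.Gamma (Set.Ici x ∩ Set.Ici y)) := by
  let g := Algebra.TensorProduct.lift
    (Algebra.ofId (S.O x) (S.Gamma (Set.Ici x ∩ Set.Ici y)))
    (IsScalarTower.toAlgHom (S.Gamma Set.univ) (S.O y) (S.Gamma (Set.Ici x ∩ Set.Ici y)))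
    (fun _ _ => Commute.all _ _)
  have hg : Function.Bijective g := hS.2.1 x y g.toRingHom fun a b z => by
    change (g (a ⊗ₜ b)).1 z = _
    rw [Algebra.TensorProduct.lift_tmul, Algebra.ofId_apply, IsScalarTower.toAlgHom_apply, hx, hy]
    rfl
  exact ⟨IsBaseChange.of_equiv (LinearEquiv.ofBijective g.toLinearMap hg) fun b => by
    change g (1 ⊗ₜ b) = _
    simp [g]⟩

end FRS

namespace FRS

section Stalks

variable {S : FRS}

noncomputable local instance algebraLeft (z y : S.X) :
    Algebra (S.O z) (S.Gamma (Set.Ici z ∩ Set.Ici y)) :=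
  (S.stalkSect Set.inter_subset_left).toAlgebra

noncomputable local instance algebraRight (z y : S.X) :
    Algebra (S.O y) (S.Gamma (Set.Ici z ∩ Set.Ici y)) :=
  (S.stalkSect Set.inter_subset_right).toAlgebra

local instance (z y : S.X) :
    IsScalarTower (S.Gamma Set.univ) (S.O z) (S.Gamma (Set.Ici z ∩ Set.Ici y)) :=
  .of_algebraMap_eq fun a => Subtype.ext (funext fun w => (res_toStalk w.2.1 a).symm)

local instance (z y : S.X) :
    IsScalarTower (S.Gamma Set.univ) (S.O y) (S.Gamma (Set.Ici z ∩ Set.Ici y)) :=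
  .of_algebraMap_eq fun a => Subtype.ext (funext fun w => (res_toStalk w.2.2 a).symm)

noncomputable local instance algebraStalk {W : Set S.X} (w : W) :
    Algebra (S.Gamma W) (S.O w.1) :=
  (S.ev w.1 w.2).toAlgebra

local instance {W : Set S.X} (w : W) :
    IsScalarTower (S.Gamma Set.univ) (S.Gamma W) (S.O w.1) :=
  .of_algebraMap_eq fun _ => rfl

noncomputable local instance algebraStalkRight {z y : S.X} (w : ↥(Set.Ici z ∩ Set.Ici y)) :
    Algebra (S.O y) (S.O w.1) :=
  (S.res w.2.2).toAlgebra

local instance {z y : S.X} (w : ↥(Set.Ici z ∩ Set.Ici y)) :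
    IsScalarTower (S.O y) (S.Gamma (Set.Ici z ∩ Set.Ici y)) (S.O w.1) :=
  .of_algebraMap_eq fun _ => rfl

noncomputable local instance moduleStalk (M : S.Mod) {W : Set S.X} (w : W) :
    Module (S.Gamma W) (M.M w.1) :=
  Module.compHom _ (S.ev w.1 w.2)

local instance (M : S.Mod) {W : Set S.X} (w : W) :
    IsScalarTower (S.Gamma W) (S.O w.1) (M.M w.1) :=
  ⟨fun a b m => mul_smul (S.ev w.1 w.2 a) b m⟩

local instance (M : S.Mod) {W : Set S.X} (w : W) :
    IsScalarTower (S.Gamma Set.univ) (S.Gamma W) (M.M w.1) :=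
  ⟨fun a b m => mul_smul (S.toStalk w.1 a) (S.ev w.1 w.2 b) m⟩

noncomputable local instance moduleStalkRight (M : S.Mod) {z y : S.X}
    (w : ↥(Set.Ici z ∩ Set.Ici y)) : Module (S.O y) (M.M w.1) :=
  Module.compHom _ (S.res w.2.2)

local instance (M : S.Mod) {z y : S.X} (w : ↥(Set.Ici z ∩ Set.Ici y)) :
    IsScalarTower (S.O y) (S.O w.1) (M.M w.1) :=
  ⟨fun a b m => mul_smul (S.res w.2.2 a) b m⟩

local instance (M : S.Mod) {z y : S.X} (w : ↥(Set.Ici z ∩ Set.Ici y)) :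
    IsScalarTower (S.O y) (S.Gamma (Set.Ici z ∩ Set.Ici y)) (M.M w.1) :=
  ⟨fun a b m => mul_smul (S.res w.2.2 a) (S.ev w.1 w.2 b) m⟩

theorem IsAffine.faithfullyFlat_inter (hS : S.IsAffine) (z y : S.X) :
    Module.FaithfullyFlat (S.Gamma (Set.Ici z ∩ Set.Ici y))
      (∀ w : ↥(Set.Ici z ∩ Set.Ici y), S.O w.1) :=
  hS.2.2 z y

/-- The restriction `M_y → M_w`, linear over `O_y`. -/
noncomputable def Mod.resStalk (M : S.Mod) {z y : S.X} (w : ↥(Set.Ici z ∩ Set.Ici y)) :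
    M.M y →ₗ[S.O y] M.M w.1 :=
  { M.res w.2.2 with map_smul' := M.res_smul w.2.2 }

theorem Mod.IsQcoh.isBaseChange_resStalk {M : S.Mod} (hM : M.IsQcoh) {z y : S.X}
    (w : ↥(Set.Ici z ∩ Set.Ici y)) : IsBaseChange (S.O w.1) (M.resStalk w) :=
  hM.isBaseChange w.2.2 rfl _ fun _ => rfl

/-- Elements of `O_z ⊗ M_y` are determined by their values at the points of `U_y ∩ U_z`. -/
theorem Mod.IsQcoh.eq_zero_of_tensorStalk {M : S.Mod} (hM : M.IsQcoh) (hS : S.IsAffine)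
    {y z : S.X} {τ : S.O z ⊗[S.Gamma Set.univ] M.M y}
    (hτ : ∀ (w : S.X) (hy : y ≤ w) (hz : z ≤ w), M.tensorStalk hy hz τ = 0) : τ = 0 := by
  have := hS.faithfullyFlat_inter z y
  have := hS.isPushout z y rfl rfl
  exact Algebra.IsPushout.eq_zero_of_isBaseChange (B := S.Gamma (Set.Ici z ∩ Set.Ici y))
    (D := fun w : ↥(Set.Ici z ∩ Set.Ici y) => S.O w.1) hM.isBaseChange_resStalk
    (θ := fun w => (M.tensorStalk w.2.2 w.2.1).toAddMonoidHom) (fun _ _ _ => rfl)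
    fun w => hτ w.1 w.2.2 w.2.1

/-- `O_z ⊗ M_y` is the module of sections of `M` over `U_y ∩ U_z`. -/
theorem Mod.IsQcoh.exists_tensorStalk_eq {M : S.Mod} (hM : M.IsQcoh) (hS : S.IsAffine)
    {y z : S.X} {t : ∀ w : ↥(Set.Ici z ∩ Set.Ici y), M.M w.1}
    (ht : ∀ ⦃v w : ↥(Set.Ici z ∩ Set.Ici y)⦄ (h : v.1 ≤ w.1), M.res h (t v) = t w) :
    ∃ τ : S.O z ⊗[S.Gamma Set.univ] M.M y, ∀ w : ↥(Set.Ici z ∩ Set.Ici y),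
      M.tensorStalk w.2.2 w.2.1 τ = t w := by
  have := hS.faithfullyFlat_inter z y
  have := hS.isPushout z y rfl rfl
  refine Algebra.IsPushout.exists_lift_of_isBaseChange (B := S.Gamma (Set.Ici z ∩ Set.Ici y))
    (D := fun w : ↥(Set.Ici z ∩ Set.Ici y) => S.O w.1) hM.isBaseChange_resStalk
    (θ := fun w => (M.tensorStalk w.2.2 w.2.1).toAddMonoidHom) (fun _ _ _ => rfl)
    (fun v w h => { S.res h with commutes' := fun a => a.2 h })
    (fun v w h => { M.res h with
      map_smul' := fun a m => (M.res_smul h _ m).trans (congrArg (· • _) (a.2 h)) })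
    (fun v w h => M.res_smul h) (fun v w h => M.res_trans v.2.2 h) (fun u v τ hτ => ?_) ht
  exact hM.eq_zero_of_tensorStalk hS fun w hu hv =>
    hτ ⟨w, v.2.1.trans hv, v.2.2.trans hv⟩ hu hv (M.tensorStalk hu hv).toAddMonoidHom
      fun _ _ => rfl

end Stalks

end FRS

namespace FRS

namespace Mod

variable {S : FRS} (M : S.Mod)

/-- The sections over `W` form a module over every ring mapping to `O(W)`. -/
noncomputable abbrev sectModule {R : Type*} [CommRing R] {W : Set S.X} (ρ : R →+* S.Gamma W) :
    Module R ↥(M.sect W) where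
  smul a s := ⟨fun z => (ρ a).1 z • s.1 z, fun z w h => by
    rw [M.res_smul, (ρ a).2 h, s.2 h]⟩
  one_smul s := Subtype.ext (funext fun z => by
    change (ρ 1).1 z • s.1 z = s.1 z
    rw [map_one]
    exact one_smul _ _)
  mul_smul a b s := Subtype.ext (funext fun z => by
    change (ρ (a * b)).1 z • s.1 z = (ρ a).1 z • (ρ b).1 z • s.1 z
    rw [map_mul]
    exact mul_smul _ _ _)
  smul_zero a := Subtype.ext (funext fun z => smul_zero _)
  smul_add a s t := Subtype.ext (funext fun z => smul_add _ _ _)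
  add_smul a b s := Subtype.ext (funext fun z => by
    change (ρ (a + b)).1 z • s.1 z = (ρ a).1 z • s.1 z + (ρ b).1 z • s.1 z
    rw [map_add]
    exact add_smul _ _ _)
  zero_smul s := Subtype.ext (funext fun z => by
    change (ρ 0).1 z • s.1 z = 0
    rw [map_zero]
    exact zero_smul _ _)

/-- Restriction of sections of a module sheaf. -/
noncomputable def resSect {V W : Set S.X} (h : W ⊆ V) :
    ↥(M.sect V) →ₗ[S.Gamma Set.univ] ↥(M.sect W) where
  toFun s := ⟨fun z => s.1 ⟨z.1, h z.2⟩,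
    fun z w hzw => s.2 (z := ⟨z.1, h z.2⟩) (w := ⟨w.1, h w.2⟩) hzw⟩
  map_add' _ _ := rfl
  map_smul' _ _ := rfl

/-- The value of a section at a point. -/
noncomputable def evSect {V : Set S.X} (v : V) :
    ↥(M.sect V) →ₗ[S.Gamma Set.univ] M.M v.1 where
  toFun s := s.1 v
  map_add' _ _ := rfl
  map_smul' _ _ := rfl

theorem isModuleOfSections_evSect (V : Set S.X) :
    IsModuleOfSections (V := V) (F := fun v => M.M v.1) (fun _ _ h => M.resₗ h)
      (M.evSect (V := V)) :=
  ⟨fun _ _ h s => s.2 h, fun _ hs => Subtype.ext (funext hs),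
    fun t ht => ⟨⟨t, ht⟩, fun _ => rfl⟩⟩

noncomputable local instance sectModuleStalk (V : Set S.X) (x : S.X) :
    Module (S.O x) ↥(M.sect (V ∩ Set.Ici x)) :=
  M.sectModule (S.stalkSect Set.inter_subset_right)

theorem sectModuleStalk_smul_apply {V : Set S.X} {x : S.X} (a : S.O x)
    (s : ↥(M.sect (V ∩ Set.Ici x))) (z : ↥(V ∩ Set.Ici x)) (hx : x ≤ z.1) :
    (a • s).1 z = S.res hx a • s.1 z := rfl

local instance (V : Set S.X) (x : S.X) :
    IsScalarTower (S.Gamma Set.univ) (S.O x) ↥(M.sect (V ∩ Set.Ici x)) :=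
  ⟨fun a b s => Subtype.ext (funext fun z => by
    have hx : x ≤ z.1 := z.2.2
    change S.res hx (S.toStalk x a * b) • s.1 z = S.toStalk z.1 a • S.res hx b • s.1 z
    rw [map_mul, res_toStalk, mul_smul])⟩

theorem liftBaseChange_resSect_apply {V : Set S.X} {x : S.X}
    (t : S.O x ⊗[S.Gamma Set.univ] ↥(M.sect V)) (v : V) (z : ↥(V ∩ Set.Ici x))
    (h : v.1 ≤ z.1) (hx : x ≤ z.1) :
    ((M.resSect Set.inter_subset_left : _ →ₗ[_] ↥(M.sect (V ∩ Set.Ici x))).liftBaseChange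
      (S.O x) t).1 z = M.tensorStalk h hx ((M.evSect v).lTensor (S.O x) t) := by
  induction t with
  | zero => simp
  | tmul a s =>
    rw [LinearMap.liftBaseChange_tmul, LinearMap.lTensor_tmul, tensorStalk_tmul,
      sectModuleStalk_smul_apply _ _ _ _ hx]
    exact congrArg (_ • ·) (s.2 (z := v) (w := ⟨z.1, z.2.1⟩) h).symm
  | add a b ha hb =>
    rw [map_add, map_add, map_add, ← ha, ← hb]
    rfl

/-- Sections of a quasi-coherent module over `V ∩ U_x` are the base change to `O_x` of the sections
over `V`. -/
theorem IsQcoh.isBaseChange_resSect {M : S.Mod} (hM : M.IsQcoh) (hS : S.IsAffine)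
    {V : Set S.X} (hV : IsUpperSet V) (x : S.X) :
    IsBaseChange (S.O x)
      (M.resSect Set.inter_subset_left : _ →ₗ[_] ↥(M.sect (V ∩ Set.Ici x))) := by
  have := hS.flat_stalk x
  have hsec := (M.isModuleOfSections_evSect V).lTensor (S.O x)
  refine IsBaseChange.of_equiv (LinearEquiv.ofBijective
    ((M.resSect Set.inter_subset_left : _ →ₗ[_] ↥(M.sect (V ∩ Set.Ici x))).liftBaseChange
      (S.O x)) ⟨(injective_iff_map_eq_zero _).2 fun t ht => hsec.eq_zero t fun v =>
        hM.eq_zero_of_tensorStalk hS fun w hv hx => ?_, fun s => ?_⟩) fun s => ?_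
  · rw [← M.liftBaseChange_resSect_apply t v ⟨w, hV hv v.2, hx⟩ hv hx, ht]
    rfl
  · have hloc (v : V) := hM.exists_tensorStalk_eq hS (y := v.1) (z := x)
      (t := fun w => s.1 ⟨w.1, hV w.2.2 v.2, w.2.1⟩) fun u w h =>
        s.2 (z := ⟨u.1, hV u.2.2 v.2, u.2.1⟩) (w := ⟨w.1, hV w.2.2 v.2, w.2.1⟩) h
    choose τ hτ using hloc
    obtain ⟨t, ht⟩ := hsec.exists_lift τ fun v w h => by
      rw [← sub_eq_zero]
      refine hM.eq_zero_of_tensorStalk hS fun u hw hx => ?_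
      have hcomp (σ : S.O x ⊗[S.Gamma Set.univ] M.M v.1) :
          M.tensorStalk hw hx ((M.resₗ h).lTensor (S.O x) σ) =
            M.tensorStalk (le_trans h hw) hx σ := by
        induction σ with
        | zero => simp
        | tmul a m => exact congrArg (S.res hx a • ·) (M.res_trans h hw m)
        | add a b ha hb => simp [ha, hb]
      rw [map_sub, hcomp, sub_eq_zero]
      exact (hτ v ⟨u, hx, le_trans h hw⟩).trans (hτ w ⟨u, hx, hw⟩).symm
    refine ⟨t, Subtype.ext (funext fun z => ?_)⟩
    rw [M.liftBaseChange_resSect_apply t ⟨z.1, z.2.1⟩ z le_rfl z.2.2, ht]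
    exact hτ ⟨z.1, z.2.1⟩ ⟨z.1, z.2.2, le_rfl⟩
  · exact (LinearMap.liftBaseChange_tmul _ _ _ _).trans (one_smul _ _)

noncomputable local instance sectModuleOpen {U : Set S.X} (V : Set S.X) (z : U) :
    Module (S.Gamma U) ↥(M.sect (V ∩ Set.Ici z.1)) :=
  Module.compHom _ (S.ev z.1 z.2)

noncomputable local instance algebraOpen {U : Set S.X} (z : U) : Algebra (S.Gamma U) (S.O z.1) :=
  (S.ev z.1 z.2).toAlgebra

local instance {U : Set S.X} (z : U) :
    IsScalarTower (S.Gamma Set.univ) (S.Gamma U) (S.O z.1) :=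
  .of_algebraMap_eq fun _ => rfl

local instance {U : Set S.X} (V : Set S.X) (z : U) :
    IsScalarTower (S.Gamma U) (S.O z.1) ↥(M.sect (V ∩ Set.Ici z.1)) :=
  ⟨fun a b s => mul_smul (S.ev z.1 z.2 a) b s⟩

local instance {U : Set S.X} (V : Set S.X) (z : U) :
    IsScalarTower (S.Gamma Set.univ) (S.Gamma U) ↥(M.sect (V ∩ Set.Ici z.1)) :=
  ⟨fun a b s => by
    change (algebraMap (S.Gamma Set.univ) (S.O z.1) a * S.ev z.1 z.2 b) • s =
      a • S.ev z.1 z.2 b • s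
    rw [mul_smul, algebraMap_smul]⟩

theorem _root_.FRS.IsAffineOpen.faithfullyFlat {U : Set S.X} (hU : S.IsAffineOpen U) :
    Module.FaithfullyFlat (S.Gamma U) (∀ z : U, S.O z.1) := by
  let f : S.Gamma U →+* (S.restrict U).Gamma Set.univ :=
    { toFun := fun s => ⟨fun z => s.1 z.1, fun z w h => s.2 h⟩
      map_one' := rfl
      map_mul' := fun _ _ => rfl
      map_zero' := rfl
      map_add' := fun _ _ => rfl }
  have hf : Function.Bijective f :=
    ⟨fun s t h => Subtype.ext (funext fun z =>
        congrFun (congrArg Subtype.val h) ⟨z, trivial⟩),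
      fun s => ⟨⟨fun z => s.1 ⟨z, trivial⟩, fun z w h => s.2 (z := ⟨z, trivial⟩)
        (w := ⟨w, trivial⟩) h⟩, rfl⟩⟩
  let _ : Algebra (S.Gamma U) ((S.restrict U).Gamma Set.univ) := f.toAlgebra
  let _ : Module ((S.restrict U).Gamma Set.univ) (∀ z : U, S.O z.1) :=
    Module.compHom (∀ z, (S.restrict U).O z) (S.restrict U).toProd
  have : IsScalarTower (S.Gamma U) ((S.restrict U).Gamma Set.univ) (∀ z : U, S.O z.1) :=
    ⟨fun a b c => mul_smul (f a) b c⟩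
  have : Module.FaithfullyFlat ((S.restrict U).Gamma Set.univ) (∀ z : U, S.O z.1) := hU.2.1
  have : Module.FaithfullyFlat (S.Gamma U) ((S.restrict U).Gamma Set.univ) :=
    Module.FaithfullyFlat.of_linearEquiv (S.Gamma U) _
      (LinearEquiv.ofBijective (Algebra.linearMap _ _) hf).symm
  exact Module.FaithfullyFlat.trans (S.Gamma U) ((S.restrict U).Gamma Set.univ) _

/-- Restriction from `V ∩ U_z` to `V ∩ U_w`, linear over the sections on an open set. -/
noncomputable def resInter {U : Set S.X} (V : Set S.X) ⦃z w : U⦄ (h : z ≤ w) :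
    ↥(M.sect (V ∩ Set.Ici z.1)) →ₗ[S.Gamma U] ↥(M.sect (V ∩ Set.Ici w.1)) :=
  { M.resSect (Set.inter_subset_inter_right V (Set.Ici_subset_Ici.2 h)) with
    map_smul' := fun a s => Subtype.ext (funext fun v => by
      have hw : w.1 ≤ v.1 := v.2.2
      have hz : z.1 ≤ v.1 := le_trans h hw
      change S.res hz (a.1 z) • s.1 ⟨v.1, v.2.1, hz⟩ = S.res hw (a.1 w) • s.1 ⟨v.1, v.2.1, hz⟩
      rw [← a.2 h, res_res]) }

theorem resInter_smul {U V : Set S.X} ⦃z w : U⦄ (h : z ≤ w) (a : S.O z.1)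
    (s : ↥(M.sect (V ∩ Set.Ici z.1))) :
    M.resInter V h (a • s) = S.res h a • M.resInter V h s :=
  Subtype.ext (funext fun v => by
    have hw : w.1 ≤ v.1 := v.2.2
    have hz : z.1 ≤ v.1 := le_trans h hw
    change S.res hz a • s.1 ⟨v.1, v.2.1, hz⟩ = S.res hw (S.res h a) • s.1 ⟨v.1, v.2.1, hz⟩
    rw [res_res])

/-- The natural map `O(U) ⊗ M(V) → M(V ∩ U_z)` for `z ∈ U`. -/
noncomputable def tensorInter {U : Set S.X} (V : Set S.X) (z : U) :
    S.Gamma U ⊗[S.Gamma Set.univ] ↥(M.sect V) →ₗ[S.Gamma U] ↥(M.sect (V ∩ Set.Ici z.1)) :=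
  (M.resSect Set.inter_subset_left).liftBaseChange (S.Gamma U)

theorem tensorInter_tmul_apply {U V : Set S.X} (z : U) (a : S.Gamma U) (s : ↥(M.sect V))
    (v : ↥(V ∩ Set.Ici z.1)) (hU : v.1 ∈ U) :
    (M.tensorInter V z (a ⊗ₜ s)).1 v = a.1 ⟨v.1, hU⟩ • s.1 ⟨v.1, v.2.1⟩ := by
  rw [tensorInter, LinearMap.liftBaseChange_tmul]
  exact congrArg (· • s.1 ⟨v.1, v.2.1⟩) (a.2 (w := ⟨v.1, hU⟩) v.2.2)

/-- `O(U) ⊗ M(V)` is obtained by gluing the modules `M(V ∩ U_z)` for `z ∈ U`. -/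
theorem IsQcoh.isModuleOfSections_tensorInter {M : S.Mod} (hM : M.IsQcoh) (hS : S.IsAffine)
    {U V : Set S.X} (hV : IsUpperSet V) (hU : S.IsAffineOpen U) :
    IsModuleOfSections (M.resInter (U := U) V) (M.tensorInter V) := by
  have := hU.faithfullyFlat
  refine IsModuleOfSections.of_isBaseChange (S.Gamma Set.univ) (fun z : U => S.O z.1)
    (fun z w h => { S.res h with commutes' := fun a => a.2 h }) _ (fun z w h => M.resInter_smul h)
    (fun y z τ hτ => ?_) _ (fun z w h n => ?_) fun z =>
      (hM.isBaseChange_resSect hS hV z.1).liftBaseChange_of_tower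
  · have hbc := hM.isBaseChange_resSect hS (hV.inter (isUpperSet_Ici y.1)) z.1
    refine hbc.equiv.injective ?_
    rw [map_zero]
    refine Subtype.ext (funext fun w => ?_)
    have hy : y.1 ≤ w.1 := w.2.1.2
    have hz : z.1 ≤ w.1 := w.2.2
    have hsub : V ∩ Set.Ici w.1 ⊆ V ∩ Set.Ici y.1 ∩ Set.Ici z.1 :=
      fun v hv => ⟨⟨hv.1, hy.trans hv.2⟩, hz.trans hv.2⟩
    have h := hτ ⟨w.1, hU.1 hy y.2⟩ hy hz
      ((M.resSect hsub).toAddMonoidHom.comp hbc.equiv.toLinearMap.toAddMonoidHom) fun d f => by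
        change M.resSect hsub (hbc.equiv (d ⊗ₜ f)) = _
        rw [hbc.equiv_tmul]
        refine Subtype.ext (funext fun v => ?_)
        have hv : w.1 ≤ v.1 := v.2.2
        change S.res (hz.trans hv) d • f.1 ⟨v.1, v.2.1, hy.trans hv⟩ =
          S.res hv (S.res hz d) • f.1 ⟨v.1, v.2.1, hy.trans hv⟩
        rw [res_res]
    exact congrFun (congrArg Subtype.val h) ⟨w.1, w.2.1.1, le_rfl⟩
  · induction n with
    | zero => simp
    | tmul a s =>
      refine Subtype.ext (funext fun v => ?_)
      have hw : w.1 ≤ v.1 := v.2.2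
      have hvU : v.1 ∈ U := hU.1 hw w.2
      exact (M.tensorInter_tmul_apply z a s ⟨v.1, v.2.1, le_trans h hw⟩ hvU).trans
        (M.tensorInter_tmul_apply w a s v hvU).symm
    | add a b ha hb => rw [map_add, map_add, map_add, ha, hb]

/-- A linear map `M(V) ⊗ O(U) → M(U ∩ V)` with the values of the natural one is bijective. -/
theorem IsQcoh.bijective_of_tmul {M : S.Mod} (hM : M.IsQcoh) (hS : S.IsAffine)
    {U V : Set S.X} (hV : IsUpperSet V) (hU : S.IsAffineOpen U)
    (ψ : ↥(M.sect V) ⊗[S.Gamma Set.univ] S.Gamma U →ₗ[S.Gamma Set.univ] ↥(M.sect (U ∩ V)))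
    (hψ : ∀ (s : ↥(M.sect V)) (t : S.Gamma U) (z : ↥(U ∩ V)),
      (ψ (s ⊗ₜ t)).1 z = t.1 ⟨z.1, z.2.1⟩ • s.1 ⟨z.1, z.2.2⟩) :
    Function.Bijective ψ := by
  have hsec := hM.isModuleOfSections_tensorInter hS hV hU
  let c := TensorProduct.comm (S.Gamma Set.univ) ↥(M.sect V) (S.Gamma U)
  have hval (t : ↥(M.sect V) ⊗[S.Gamma Set.univ] S.Gamma U) (z : U)
      (v : ↥(V ∩ Set.Ici z.1)) (hv : v.1 ∈ U) :
      (M.tensorInter V z (c t)).1 v = (ψ t).1 ⟨v.1, hv, v.2.1⟩ := by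
    induction t with
    | zero => simp
    | tmul s t =>
      exact (M.tensorInter_tmul_apply z t s v hv).trans (hψ s t ⟨v.1, hv, v.2.1⟩).symm
    | add a b ha hb =>
      rw [map_add, map_add, map_add]
      exact congrArg₂ (· + ·) ha hb
  refine ⟨fun a b hab => c.injective (sub_eq_zero.1 (hsec.eq_zero _ fun z => ?_)), fun σ => ?_⟩
  · rw [map_sub, sub_eq_zero]
    refine Subtype.ext (funext fun v => ?_)
    rw [hval a z v (hU.1 v.2.2 z.2), hval b z v (hU.1 v.2.2 z.2), hab]
  · have hsub (z : U) : V ∩ Set.Ici z.1 ⊆ U ∩ V := fun v hv => ⟨hU.1 hv.2 z.2, hv.1⟩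
    obtain ⟨n, hn⟩ := hsec.exists_lift (fun z => M.resSect (hsub z) σ) fun z w h => rfl
    refine ⟨c.symm n, Subtype.ext (funext fun v => ?_)⟩
    have h := hval (c.symm n) ⟨v.1, v.2.1⟩ ⟨v.1, v.2.2, le_rfl⟩ v.2.1
    rw [c.apply_symm_apply, hn] at h
    exact h.symm

end Mod

end FRS

/-- Let `X` be an affine finite space, `M` a quasi-coherent `O_X`-module,
`V ⊆ X` an open subset and `U ⊆ X` an affine open subset.  Then the natural morphism
`M(V) ⊗_{O(X)} O(U) → M(U ∩ V)` (characterized on simple tensors: `s ⊗ t` goes to the section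
`z ↦ t(z) • s(z)`) is an isomorphism. -/
theorem FRS.Mod.sect_tensor_isAffineOpen (S : FRS) (hS : S.IsAffine)
    (M : S.Mod) (hM : M.IsQcoh)
    (V : Set S.X) (hV : IsUpperSet V)
    (U : Set S.X) (hU : S.IsAffineOpen U) :
    ∀ ψ : ((↥(M.sect V)) ⊗[S.Gamma Set.univ] (S.Gamma U)) →ₗ[S.Gamma Set.univ]
        ↥(M.sect (U ∩ V)),
      (∀ (s : ↥(M.sect V)) (t : S.Gamma U) (w : ↥(M.sect (U ∩ V))),
        (∀ z : ↥(U ∩ V),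
            (w : ∀ z : ↥(U ∩ V), M.M z.1) z
              = ((t : ∀ z : U, S.O z.1) ⟨z.1, z.2.1⟩) •
                  ((s : ∀ z : V, M.M z.1) ⟨z.1, z.2.2⟩)) →
        ψ (s ⊗ₜ t) = w) →
      Function.Bijective ψ := by
  intro ψ hψ
  refine hM.bijective_of_tmul hS hV hU ψ fun s t z => ?_
  rw [hψ s t ⟨fun x => t.1 ⟨x.1, x.2.1⟩ • s.1 ⟨x.1, x.2.2⟩, fun x y h => by
    rw [M.res_smul]
    exact congrArg₂ (· • ·) (t.2 (z := ⟨x.1, x.2.1⟩) (w := ⟨y.1, y.2.1⟩) h)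
      (s.2 (z := ⟨x.1, x.2.2⟩) (w := ⟨y.1, y.2.2⟩) h)⟩ fun _ => rfl]
end

section
/- The intersection of two affine open subsets of an affine finite space is affine. -/
open scoped TensorProduct

/-- The components of a flat ring homomorphism into a product are flat. -/
theorem RingHom.Flat.of_pi {ι R : Type*} [CommRing R] {B : ι → Type*} [∀ i, CommRing (B i)]
    {f : ∀ i, R →+* B i} (hf : (RingHom.pi f).Flat) (i : ι) : (f i).Flat := by
  classical
  let (i : ι) : Algebra R (B i) := (f i).toAlgebra
  have : Module.Flat R (∀ i, B i) := hf
  exact Module.Flat.of_retract (LinearMap.single R B i) (LinearMap.proj i)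
    (LinearMap.proj_comp_single_same R B i)

/-- A ring homomorphism into a finite product is flat if its components are. -/
theorem RingHom.Flat.pi {ι R : Type*} [_root_.Finite ι] [CommRing R] {B : ι → Type*}
    [∀ i, CommRing (B i)] {f : ∀ i, R →+* B i} (hf : ∀ i, (f i).Flat) : (RingHom.pi f).Flat := by
  classical
  cases nonempty_fintype ι
  let (i : ι) : Algebra R (B i) := (f i).toAlgebra
  have (i : ι) : Module.Flat R (B i) := hf i
  exact Module.Flat.of_linearEquiv (DirectSum.linearEquivFunOnFintype R ι B).symm

/-- If `R → ∏ B i` is faithfully flat, every nonzero `R`-algebra has a nonzero common extension with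
one of the factors `B i`. -/
theorem RingHom.FaithfullyFlat.exists_nontrivial_extension {ι R E : Type} [_root_.Finite ι]
    [CommRing R] [CommRing E] [Nontrivial E] {B : ι → Type} [∀ i, CommRing (B i)]
    {f : ∀ i, R →+* B i} (hf : (RingHom.pi f).FaithfullyFlat) (g : R →+* E) :
    ∃ (i : ι) (F : Type) (_ : CommRing F) (_ : Nontrivial F) (h : B i →+* F) (k : E →+* F),
      h.comp (f i) = k.comp g := by
  classical
  cases nonempty_fintype ι
  let (i : ι) : Algebra R (B i) := (f i).toAlgebra
  let : Algebra R E := g.toAlgebra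
  have : Module.FaithfullyFlat R (∀ i, B i) := hf
  have hE : Nontrivial (E ⊗[R] (∀ i, B i)) := inferInstance
  rw [(TensorProduct.piRight R R E B).toEquiv.nontrivial_congr] at hE
  obtain ⟨i, hi⟩ : ∃ i, Nontrivial (E ⊗[R] B i) := by
    by_contra! h
    exact not_subsingleton _ (inferInstance : Subsingleton (∀ i, E ⊗[R] B i))
  refine ⟨i, E ⊗[R] B i, inferInstance, hi, Algebra.TensorProduct.includeRight.toRingHom,
    Algebra.TensorProduct.includeLeftRingHom, ?_⟩
  ext r
  exact (Algebra.TensorProduct.includeRight (R := R) (A := E) (B := B i)).commutes r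

/-- Descent of elements along a faithfully flat homomorphism into a finite product. -/
theorem RingHom.FaithfullyFlat.mem_range_of_tmul_eq {ι R : Type*} [_root_.Finite ι] [CommRing R]
    {B : ι → Type*} [∀ i, CommRing (B i)] [∀ i, Algebra R (B i)]
    (hf : (RingHom.pi fun i => algebraMap R (B i)).FaithfullyFlat) (s : ∀ i, B i)
    (hs : ∀ i j, s i ⊗ₜ[R] (1 : B j) = (1 : B i) ⊗ₜ[R] s j) :
    s ∈ (RingHom.pi fun i => algebraMap R (B i)).range := by
  classical
  cases nonempty_fintype ι
  have : Module.FaithfullyFlat R (∀ i, B i) := RingHom.faithfullyFlat_algebraMap_iff.1 hf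
  let I : Submodule R (∀ i, B i) := LinearMap.range (Algebra.linearMap R (∀ i, B i))
  have key : s ⊗ₜ[R] (1 : ∀ i, B i) = (1 : ∀ i, B i) ⊗ₜ[R] s := by
    apply (TensorProduct.piRight R R (∀ i, B i) B).injective
    ext j
    apply ((TensorProduct.comm R _ _).trans (TensorProduct.piRight R R (B j) B)).injective
    ext i
    have := congrArg (TensorProduct.comm R _ _) (hs i j)
    simpa using this
  have h0 : I.mkQ s = 0 := by
    apply Module.FaithfullyFlat.tensorProduct_mk_injective (A := R) (B := ∀ i, B i)
      ((∀ i, B i) ⧸ I)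
    have h1 : I.mkQ 1 = 0 := (Submodule.Quotient.mk_eq_zero I).2 ⟨1, by ext; simp⟩
    have := congrArg (LinearMap.lTensor (∀ i, B i) I.mkQ) key
    rw [LinearMap.lTensor_tmul, LinearMap.lTensor_tmul, h1, TensorProduct.tmul_zero] at this
    simpa using this.symm
  obtain ⟨r, hr⟩ := (Submodule.Quotient.mk_eq_zero I).1 h0
  exact ⟨r, hr⟩

section

open Algebra.TensorProduct

/-- A ring homomorphism out of a tensor product over `G` is bijective if its pullback to the
tensor product over a ring `A` mapping to `G` is. -/
theorem TensorProduct.bijective_of_comp_algebraMap {A G P Q D : Type*} [CommRing A] [CommRing G]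
    [CommRing P] [CommRing Q] [CommRing D] [Algebra A G] [Algebra A P] [Algebra A Q]
    [Algebra G P] [Algebra G Q] [IsScalarTower A G P] [IsScalarTower A G Q]
    (ψ : P ⊗[G] Q →+* D) (χ : P ⊗[A] Q →+* D) (h : ∀ p q, ψ (p ⊗ₜ q) = χ (p ⊗ₜ q))
    (hχ : Function.Bijective χ) : Function.Bijective ψ := by
  have hcomp : ψ.comp (Algebra.TensorProduct.mapOfCompatibleSMul G A A P Q).toRingHom = χ := by
    ext p <;> simp [h]
  have hs := Algebra.TensorProduct.mapOfCompatibleSMul_surjective G A A P Q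
  have hc : ψ ∘ Algebra.TensorProduct.mapOfCompatibleSMul G A A P Q = χ :=
    congrArg DFunLike.coe hcomp
  rw [← hc] at hχ
  exact ⟨hχ.1.of_comp_right hs, hχ.2.of_comp⟩

/-- Let `p i : P → C i` and `q i : Q → C i` be finitely many pairs of flat `A`-algebra
homomorphisms with `C i ⊗[A] C i → C i` flat, such that every nonzero ring under `P` and `Q` has a
nonzero common extension with some `C i`. Then `P ⊗[A] Q → ∏ C i` is faithfully flat. -/
theorem Algebra.TensorProduct.faithfullyFlat_pi_lift {ι A P Q : Type} [Finite ι] [CommRing A]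
    [CommRing P] [CommRing Q] [Algebra A P] [Algebra A Q] {C : ι → Type} [∀ i, CommRing (C i)]
    [∀ i, Algebra A (C i)] (p : ∀ i, P →ₐ[A] C i) (q : ∀ i, Q →ₐ[A] C i)
    (hp : ∀ i, (p i).toRingHom.Flat) (hq : ∀ i, (q i).toRingHom.Flat)
    (hC : ∀ i, (lmul' A (S := C i)).toRingHom.Flat)
    (hex : ∀ (K : Type) [CommRing K] [Nontrivial K] (f : P →+* K) (g : Q →+* K),
      f.comp (algebraMap A P) = g.comp (algebraMap A Q) →
      ∃ (i : ι) (F : Type) (_ : CommRing F) (_ : Nontrivial F) (h : C i →+* F) (k : K →+* F),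
        h.comp (p i) = k.comp f ∧ h.comp (q i) = k.comp g) :
    (RingHom.pi fun i => (productMap (p i) (q i)).toRingHom).FaithfullyFlat := by
  let (i : ι) : Algebra (P ⊗[A] Q) (C i) := (productMap (p i) (q i)).toRingHom.toAlgebra
  have hflat : (RingHom.pi fun i => (productMap (p i) (q i)).toRingHom).Flat :=
    RingHom.Flat.pi fun i => by
      have : (productMap (p i) (q i)).toRingHom =
          (lmul' A (S := C i)).toRingHom.comp (map (p i) (q i)).toRingHom := by
        ext <;> simp
      rw [this]
      exact (RingHom.Flat.tensorProductMap (hp i) (hq i)).comp (hC i)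
  have : Module.Flat (P ⊗[A] Q) (∀ i, C i) := hflat
  change Module.FaithfullyFlat (P ⊗[A] Q) (∀ i, C i)
  refine ⟨fun m hm htop => ?_⟩
  let π := Ideal.Quotient.mk m
  have : Nontrivial (P ⊗[A] Q ⧸ m) := Ideal.Quotient.nontrivial_iff.2 hm.ne_top
  obtain ⟨i, F, _, _, h, k, h₁, h₂⟩ := hex (P ⊗[A] Q ⧸ m)
    (π.comp includeLeftRingHom) (π.comp (includeRight : Q →ₐ[A] P ⊗[A] Q).toRingHom) (by
      ext a
      simp [π])
  have hπ : h.comp (productMap (p i) (q i)).toRingHom = k.comp π := by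
    ext x
    · simpa using RingHom.congr_fun h₁ x
    · simpa using RingHom.congr_fun h₂ x
  have hker : ∀ x ∈ m • (⊤ : Submodule (P ⊗[A] Q) (∀ i, C i)), h (x i) = 0 := by
    intro x hx
    induction hx using Submodule.smul_induction_on' with
    | smul r hr n _ =>
      have : h ((productMap (p i) (q i)) r) = k (π r) := RingHom.congr_fun hπ r
      rw [Ideal.Quotient.eq_zero_iff_mem.2 hr, map_zero] at this
      change h ((productMap (p i) (q i)) r * n i) = 0
      rw [map_mul, this, zero_mul]
    | add x _ y _ hx hy => rw [Pi.add_apply, map_add, hx, hy, add_zero]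
  have h1 := hker 1 (htop.symm ▸ Submodule.mem_top)
  simp at h1

end

namespace FRS

variable (S : FRS)

/-- The canonical morphism `O_x ⊗ O_y → O(U_x ∩ U_y)`. -/
noncomputable def tensorToSect (x y : S.X) :
    S.O x ⊗[S.Gamma Set.univ] S.O y →ₐ[S.Gamma Set.univ] S.Gamma (Set.Ici x ∩ Set.Ici y) :=
  Algebra.TensorProduct.productMap
    { S.stalkSect (x := x) Set.inter_subset_left with
      commutes' := fun s => Subtype.ext <| funext fun z =>
        s.2 (z := ⟨x, trivial⟩) (w := ⟨z.1, trivial⟩) z.2.1 }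
    { S.stalkSect (x := y) Set.inter_subset_right with
      commutes' := fun s => Subtype.ext <| funext fun z =>
        s.2 (z := ⟨y, trivial⟩) (w := ⟨z.1, trivial⟩) z.2.2 }

variable {S}

theorem tensorToSect_tmul {x y : S.X} (a : S.O x) (b : S.O y)
    (z : ↥(Set.Ici x ∩ Set.Ici y)) :
    (S.tensorToSect x y (a ⊗ₜ b)).1 z = S.res z.2.1 a * S.res z.2.2 b := by
  rw [tensorToSect, Algebra.TensorProduct.productMap_apply_tmul]
  rfl

theorem IsAffine.tensorToSect_bijective (hS : S.IsAffine) (x y : S.X) :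
    Function.Bijective (S.tensorToSect x y) :=
  hS.2.1 x y (S.tensorToSect x y).toRingHom tensorToSect_tmul

theorem IsAffine.toStalk_flat (hS : S.IsAffine) (x : S.X) : (S.toStalk x).Flat :=
  RingHom.Flat.of_pi (f := S.toStalk) (RingHom.FaithfullyFlat.flat hS.1) x

theorem IsAffine.ev_flat (hS : S.IsAffine) {x y : S.X} (z : S.X)
    (hz : z ∈ Set.Ici x ∩ Set.Ici y) : (S.ev z hz).Flat :=
  RingHom.Flat.of_pi (f := fun z : ↥(Set.Ici x ∩ Set.Ici y) => S.ev z.1 z.2)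
    (RingHom.FaithfullyFlat.flat (hS.2.2 x y)) ⟨z, hz⟩

theorem IsAffine.lmul'_flat (hS : S.IsAffine) (x : S.X) :
    (Algebra.TensorProduct.lmul' (S.Gamma Set.univ) (S := S.O x)).toRingHom.Flat := by
  have hx : x ∈ Set.Ici x ∩ Set.Ici x := ⟨le_rfl, le_rfl⟩
  have : (Algebra.TensorProduct.lmul' (S.Gamma Set.univ) (S := S.O x)).toRingHom =
      (S.ev x hx).comp (S.tensorToSect x x).toRingHom := by
    ext a
    · have := S.tensorToSect_tmul a 1 ⟨x, hx⟩
      simpa [ev, S.res_refl] using this.symm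
    · have := S.tensorToSect_tmul 1 a ⟨x, hx⟩
      simpa [ev, S.res_refl] using this.symm
  rw [this]
  exact (RingHom.Flat.of_bijective (hS.tensorToSect_bijective x x)).comp (hS.ev_flat x hx)

/-- The germs of a family which is compatible on `U_x ∩ U_y` agree in `O_x ⊗ O_y`. -/
theorem IsAffine.tmul_one_eq_one_tmul (hS : S.IsAffine) {x y : S.X} (a : S.O x) (b : S.O y)
    (h : ∀ z (hx : x ≤ z) (hy : y ≤ z), S.res hx a = S.res hy b) :
    a ⊗ₜ[S.Gamma Set.univ] (1 : S.O y) = (1 : S.O x) ⊗ₜ[S.Gamma Set.univ] b := by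
  apply (hS.tensorToSect_bijective x y).1
  ext z
  rw [tensorToSect_tmul, tensorToSect_tmul, map_one, map_one, mul_one, one_mul]
  exact h z.1 z.2.1 z.2.2

variable (S)

/-- Restriction of global sections to a subset, viewed as a finite ringed space. -/
def globRes (U : Set S.X) : S.Gamma Set.univ →+* (S.restrict U).Gamma Set.univ where
  toFun s := ⟨fun z => s.1 ⟨z.1.1, trivial⟩,
    fun z w h => s.2 (z := ⟨z.1.1, trivial⟩) (w := ⟨w.1.1, trivial⟩) h⟩
  map_one' := rfl
  map_mul' _ _ := rfl
  map_zero' := rfl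
  map_add' _ _ := rfl

/-- Restriction of sections between subsets viewed as finite ringed spaces. -/
def restrictRes {U W : Set S.X} (h : W ⊆ U) :
    (S.restrict U).Gamma Set.univ →+* (S.restrict W).Gamma Set.univ where
  toFun s := ⟨fun z => s.1 ⟨⟨z.1.1, h z.1.2⟩, trivial⟩,
    fun z w hzw => s.2 (z := ⟨⟨z.1.1, h z.1.2⟩, trivial⟩) (w := ⟨⟨w.1.1, h w.1.2⟩, trivial⟩) hzw⟩
  map_one' := rfl
  map_mul' _ _ := rfl
  map_zero' := rfl
  map_add' _ _ := rfl

/-- The point of `S` underlying a point of the finite ringed space `W`. -/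
noncomputable def incl (W : Set S.X) (x : (S.restrict W).X) : S.X :=
  Subtype.val (p := (· ∈ W)) x

/-- Sections over `U_x ∩ U_y` computed in `S` and in the finite ringed space `W`. -/
noncomputable def interRes (W : Set S.X) (x y : (S.restrict W).X) :
    S.Gamma (Set.Ici (S.incl W x) ∩ Set.Ici (S.incl W y)) →+*
      (S.restrict W).Gamma (Set.Ici x ∩ Set.Ici y) where
  toFun s := ⟨fun z => s.1 ⟨S.incl W z.1, z.2⟩,
    fun z w h => s.2 (z := ⟨S.incl W z.1, z.2⟩) (w := ⟨S.incl W w.1, w.2⟩) h⟩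
  map_one' := rfl
  map_mul' _ _ := rfl
  map_zero' := rfl
  map_add' _ _ := rfl

/-- The product of the stalks over `U_x ∩ U_y` computed in `S` and in the finite ringed
space `W`. -/
noncomputable def interProd (W : Set S.X) (x y : (S.restrict W).X) :
    (∀ z : ↥(Set.Ici (S.incl W x) ∩ Set.Ici (S.incl W y)), S.O z.1) →+*
      (∀ z : ↥(Set.Ici x ∩ Set.Ici y), (S.restrict W).O z.1) :=
  RingHom.pi fun z =>
    Pi.evalRingHom (fun z : ↥(Set.Ici (S.incl W x) ∩ Set.Ici (S.incl W y)) => S.O z.1)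
      ⟨S.incl W z.1, z.2⟩

variable {S}

theorem interProd_bijective {W : Set S.X} (hW : IsUpperSet W) (x y : (S.restrict W).X) :
    Function.Bijective (S.interProd W x y) := by
  refine ⟨fun s t h => funext fun z => ?_, fun s => ?_⟩
  · exact congrFun h ⟨⟨z.1, hW z.2.1 x.2⟩, z.2⟩
  · exact ⟨fun z => s ⟨⟨z.1, hW z.2.1 x.2⟩, z.2⟩, rfl⟩

theorem interRes_bijective {W : Set S.X} (hW : IsUpperSet W) (x y : (S.restrict W).X) :
    Function.Bijective (S.interRes W x y) := by
  refine ⟨fun s t h => Subtype.ext (funext fun z => ?_), fun s => ?_⟩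
  · exact congrFun (congrArg Subtype.val h) ⟨⟨z.1, hW z.2.1 x.2⟩, z.2⟩
  · exact ⟨⟨fun z => s.1 ⟨⟨z.1, hW z.2.1 x.2⟩, z.2⟩, fun z w h =>
      s.2 (z := ⟨⟨z.1, hW z.2.1 x.2⟩, z.2⟩) (w := ⟨⟨w.1, hW w.2.1 x.2⟩, w.2⟩) h⟩, rfl⟩

/-- For an open subset of an affine finite space the tensor product condition is automatic. -/
theorem IsAffine.restrict_tensor_bijective (hS : S.IsAffine) {W : Set S.X} (hW : IsUpperSet W)
    (x y : (S.restrict W).X)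
    (ψ : (S.restrict W).O x ⊗[(S.restrict W).Gamma Set.univ] (S.restrict W).O y →+*
      (S.restrict W).Gamma (Set.Ici x ∩ Set.Ici y))
    (hψ : ∀ (a : (S.restrict W).O x) (b : (S.restrict W).O y) (z : ↥(Set.Ici x ∩ Set.Ici y)),
      (ψ (a ⊗ₜ b)).1 z = (S.restrict W).res z.2.1 a * (S.restrict W).res z.2.2 b) :
    Function.Bijective ψ := by
  let : Algebra (S.Gamma Set.univ) ((S.restrict W).Gamma Set.univ) := (S.globRes W).toAlgebra
  let (w : (S.restrict W).X) : Algebra (S.Gamma Set.univ) ((S.restrict W).O w) :=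
    S.globAlgebra (S.incl W w)
  have (w : (S.restrict W).X) : IsScalarTower (S.Gamma Set.univ)
      ((S.restrict W).Gamma Set.univ) ((S.restrict W).O w) := .of_algebraMap_eq' rfl
  refine TensorProduct.bijective_of_comp_algebraMap (A := S.Gamma Set.univ) ψ
    ((S.interRes W x y).comp (S.tensorToSect (S.incl W x) (S.incl W y)).toRingHom)
    (fun a b => ?_)
    ((interRes_bijective hW x y).comp (hS.tensorToSect_bijective (S.incl W x) (S.incl W y)))
  refine Subtype.ext (funext fun z => (hψ a b z).trans ?_)
  exact (S.tensorToSect_tmul (x := S.incl W x) (y := S.incl W y) a b ⟨S.incl W z.1, z.2⟩).symm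

/-- For an open subset of an affine finite space the last affineness condition is automatic. -/
theorem IsAffine.restrict_sectToProd (hS : S.IsAffine) {W : Set S.X} (hW : IsUpperSet W)
    (x y : (S.restrict W).X) :
    ((S.restrict W).sectToProd (Set.Ici x ∩ Set.Ici y)).FaithfullyFlat := by
  let e := RingEquiv.ofBijective _ (interRes_bijective hW x y)
  have : (S.restrict W).sectToProd (Set.Ici x ∩ Set.Ici y) =
      ((S.interProd W x y).comp (S.sectToProd (Set.Ici (S.incl W x) ∩ Set.Ici (S.incl W y)))).comp
        e.symm.toRingHom := by
    refine RingHom.ext fun s => ?_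
    obtain ⟨s, rfl⟩ := e.surjective s
    simp only [RingHom.comp_apply, RingEquiv.toRingHom_eq_coe, RingHom.coe_coe, e.symm_apply_apply]
    rfl
  rw [this]
  have hxy : (S.sectToProd (Set.Ici (S.incl W x) ∩ Set.Ici (S.incl W y))).FaithfullyFlat :=
    hS.2.2 _ _
  exact RingHom.FaithfullyFlat.stableUnderComposition _ _ (.of_bijective e.symm.bijective)
    (RingHom.FaithfullyFlat.stableUnderComposition _ _ hxy
      (.of_bijective (interProd_bijective hW x y)))

/-- Affineness of an open subset `W` of an affine finite space only requires `O(W) → ∏ O_w` to be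
faithfully flat. -/
theorem IsAffine.isAffineOpen (hS : S.IsAffine) {W : Set S.X} (hW : IsUpperSet W)
    (h : (S.restrict W).toProd.FaithfullyFlat) : S.IsAffineOpen W :=
  ⟨hW, h, hS.restrict_tensor_bijective hW, hS.restrict_sectToProd hW⟩

/-- A nonzero ring under `O(U)` and `O(V)` has a nonzero common extension with a stalk of
`U ∩ V`. -/
theorem IsAffineOpen.exists_nontrivial_extension (hS : S.IsAffine) {U V : Set S.X}
    (hU : S.IsAffineOpen U) (hV : S.IsAffineOpen V) {K : Type} [CommRing K] [Nontrivial K]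
    (f : (S.restrict U).Gamma Set.univ →+* K) (g : (S.restrict V).Gamma Set.univ →+* K)
    (hfg : f.comp (S.globRes U) = g.comp (S.globRes V)) :
    ∃ (w : ↥(U ∩ V)) (F : Type) (_ : CommRing F) (_ : Nontrivial F) (h : S.O w.1 →+* F)
      (k : K →+* F),
      h.comp ((S.restrict U).toStalk (⟨w.1, w.2.1⟩ : U)) = k.comp f ∧
      h.comp ((S.restrict V).toStalk (⟨w.1, w.2.2⟩ : V)) = k.comp g := by
  obtain ⟨u, F₁, _, _, h₁, k₁, e₁⟩ :=
    RingHom.FaithfullyFlat.exists_nontrivial_extension (f := (S.restrict U).toStalk) hU.2.1 f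
  obtain ⟨v, F₂, _, _, h₂, k₂, e₂⟩ := RingHom.FaithfullyFlat.exists_nontrivial_extension
    (f := (S.restrict V).toStalk) hV.2.1 (k₁.comp g)
  let u' : U := u
  let v' : V := v
  let : Algebra (S.Gamma Set.univ) F₂ := ((k₂.comp k₁).comp (f.comp (S.globRes U))).toAlgebra
  let α : S.O u'.1 →ₐ[S.Gamma Set.univ] F₂ :=
    { k₂.comp h₁ with
      commutes' := fun s => congrArg k₂ (RingHom.congr_fun e₁ (S.globRes U s)) }
  let β : S.O v'.1 →ₐ[S.Gamma Set.univ] F₂ :=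
    { (h₂ : S.O v'.1 →+* F₂) with
      commutes' := fun s => (RingHom.congr_fun e₂ (S.globRes V s)).trans
        (congrArg (k₂.comp k₁) (RingHom.congr_fun hfg s).symm) }
  let e := AlgEquiv.ofBijective _ (hS.tensorToSect_bijective u'.1 v'.1)
  let χ := (Algebra.TensorProduct.productMap α β).comp e.symm.toAlgHom
  obtain ⟨z, F₃, _, _, h₃, k₃, e₃⟩ := RingHom.FaithfullyFlat.exists_nontrivial_extension
    (f := fun z : ↥(Set.Ici u'.1 ∩ Set.Ici v'.1) => S.ev z.1 z.2) (hS.2.2 u'.1 v'.1) χ.toRingHom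
  have hχ (a : S.O u'.1) (b : S.O v'.1) :
      h₃ (S.res z.2.1 a * S.res z.2.2 b) = k₃ (α a * β b) := by
    have := RingHom.congr_fun e₃ (S.tensorToSect u'.1 v'.1 (a ⊗ₜ b))
    have h : χ (S.tensorToSect u'.1 v'.1 (a ⊗ₜ b)) = α a * β b := by
      refine (congrArg (Algebra.TensorProduct.productMap α β)
        (e.symm_apply_apply (a ⊗ₜ b))).trans ?_
      simp
    rw [← tensorToSect_tmul, ← h]
    exact this
  refine ⟨⟨z.1, hU.1 z.2.1 u'.2, hV.1 z.2.2 v'.2⟩, F₃, inferInstance, inferInstance, h₃,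
    (k₃.comp k₂).comp k₁, RingHom.ext fun s => ?_, RingHom.ext fun s => ?_⟩
  · have h := hχ ((S.restrict U).toStalk u s) 1
    rw [map_one, mul_one, map_one, mul_one] at h
    refine (congrArg h₃ ?_).trans (h.trans (congrArg (fun a => k₃ (k₂ a)) (RingHom.congr_fun e₁ s)))
    exact (s.2 (z := ⟨u, trivial⟩) (w := ⟨⟨z.1, hU.1 z.2.1 u'.2⟩, trivial⟩) z.2.1).symm
  · have h := hχ 1 ((S.restrict V).toStalk v s)
    rw [map_one, one_mul, map_one, one_mul] at h
    refine (congrArg h₃ ?_).trans (h.trans (congrArg k₃ (RingHom.congr_fun e₂ s)))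
    exact (s.2 (z := ⟨v, trivial⟩) (w := ⟨⟨z.1, hV.1 z.2.2 v'.2⟩, trivial⟩) z.2.2).symm

theorem IsAffineOpen.inter_toProd_faithfullyFlat (hS : S.IsAffine) {U V : Set S.X}
    (hU : S.IsAffineOpen U) (hV : S.IsAffineOpen V) :
    (S.restrict (U ∩ V)).toProd.FaithfullyFlat := by
  let A := S.Gamma Set.univ
  let P := (S.restrict U).Gamma Set.univ
  let Q := (S.restrict V).Gamma Set.univ
  let D := (S.restrict (U ∩ V)).Gamma Set.univ
  let C (w : ↥(U ∩ V)) := S.O w.1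
  let : Algebra A P := (S.globRes U).toAlgebra
  let : Algebra A Q := (S.globRes V).toAlgebra
  let : Algebra A D := (S.globRes (U ∩ V)).toAlgebra
  let p (w : ↥(U ∩ V)) : P →ₐ[A] C w :=
    { (S.restrict U).toStalk (⟨w.1, w.2.1⟩ : U) with commutes' := fun _ => rfl }
  let q (w : ↥(U ∩ V)) : Q →ₐ[A] C w :=
    { (S.restrict V).toStalk (⟨w.1, w.2.2⟩ : V) with commutes' := fun _ => rfl }
  let ρ : P →ₐ[A] D := { S.restrictRes Set.inter_subset_left with commutes' := fun _ => rfl }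
  let σ : Q →ₐ[A] D := { S.restrictRes Set.inter_subset_right with commutes' := fun _ => rfl }
  let r : P ⊗[A] Q →ₐ[A] D := Algebra.TensorProduct.productMap ρ σ
  let (w : ↥(U ∩ V)) : Algebra (P ⊗[A] Q) (C w) :=
    (Algebra.TensorProduct.productMap (p w) (q w)).toRingHom.toAlgebra
  have (w : ↥(U ∩ V)) : IsScalarTower A (P ⊗[A] Q) (C w) :=
    .of_algebraMap_eq' (Algebra.TensorProduct.productMap (p w) (q w)).comp_algebraMap.symm
  have hff : (RingHom.pi fun w => algebraMap (P ⊗[A] Q) (C w)).FaithfullyFlat :=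
    Algebra.TensorProduct.faithfullyFlat_pi_lift p q
      (fun w => hU.2.toStalk_flat _) (fun w => hV.2.toStalk_flat _)
      (fun w => hS.lmul'_flat w.1)
      (fun K _ _ f g hfg => hU.exists_nontrivial_extension hS hV f g hfg)
  have hcomp : (S.restrict (U ∩ V)).toProd.comp r.toRingHom =
      RingHom.pi fun w => algebraMap (P ⊗[A] Q) (C w) := by
    ext x w
    · exact (congrFun (congrArg (S.restrict (U ∩ V)).toProd
        (Algebra.TensorProduct.productMap_left_apply ρ σ x)) w).trans
        (Algebra.TensorProduct.productMap_left_apply (p w) (q w) x).symm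
    · exact (congrFun (congrArg (S.restrict (U ∩ V)).toProd
        (Algebra.TensorProduct.productMap_right_apply ρ σ x)) w).trans
        (Algebra.TensorProduct.productMap_right_apply (p w) (q w) x).symm
  have hr : Function.Bijective r := by
    refine ⟨fun a b hab => hff.injective ?_, fun d => ?_⟩
    · rw [← hcomp]
      exact congrArg (S.restrict (U ∩ V)).toProd hab
    · obtain ⟨x, hx⟩ := hff.mem_range_of_tmul_eq ((S.restrict (U ∩ V)).toProd d) fun w w' => by
        have := hS.tmul_one_eq_one_tmul (x := w.1) (y := w'.1)
          ((S.restrict (U ∩ V)).toStalk w d) ((S.restrict (U ∩ V)).toStalk w' d) fun z hz hz' => by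
            have hzW : z ∈ U ∩ V := ⟨hU.1 hz w.2.1, hV.1 hz w.2.2⟩
            exact (d.2 (z := ⟨w, trivial⟩) (w := ⟨⟨z, hzW⟩, trivial⟩) hz).trans
              (d.2 (z := ⟨w', trivial⟩) (w := ⟨⟨z, hzW⟩, trivial⟩) hz').symm
        exact congrArg (TensorProduct.mapOfCompatibleSMul (P ⊗[A] Q) A A (C w) (C w')) this
      refine ⟨x, ?_⟩
      rw [← hcomp] at hx
      exact Subtype.ext (funext fun z => congrFun hx z.1)
  let e := RingEquiv.ofBijective r.toRingHom hr
  have : (S.restrict (U ∩ V)).toProd =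
      (RingHom.pi fun w => algebraMap (P ⊗[A] Q) (C w)).comp e.symm.toRingHom := by
    rw [← hcomp]
    refine RingHom.ext fun d => ?_
    exact congrArg (S.restrict (U ∩ V)).toProd (e.apply_symm_apply d).symm
  rw [this]
  exact RingHom.FaithfullyFlat.stableUnderComposition _ _ (.of_bijective e.symm.bijective) hff

end FRS

/-- The intersection of two affine open subsets of an affine finite space is
affine. -/
theorem FRS.isAffineOpen_inter (S : FRS) (hS : S.IsAffine) (U V : Set S.X)
    (hU : S.IsAffineOpen U) (hV : S.IsAffineOpen V) :
    S.IsAffineOpen (U ∩ V) :=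
  hS.isAffineOpen (hU.1.inter hV.1) (hU.inter_toProd_faithfullyFlat hS hV)
end
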